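/- arXiv:2010.14719 — 3 statements merged into one kernel-verified Lean document; each statement's English description precedes it below -/
import Mathlib

section
/- Variational principle for amenable packing entropy: Let (X,G) be a G-action topological dynamical system with G a countable infinite discrete amenable group, and let {F_n} be a sequence of finite subsets of G satisfying the growth condition. Then for every non-empty Borel subset Z of X, h^P_top(Z,{F_n}) = sup{ h̄^loc_μ(Z,{F_n}) : μ a Borel probability measure on X with μ(Z) = 1 }. -/
open Filter Set MeasureTheory ENNReal Topology
open scoped Pointwise symmDiff NNReal

namespace AmenablePacking

variable {G X Y : Type*}

/-- The open dynamical (Bowen) ball of center `x` and radius `ε` over the finite set `F`. -/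
def dynBall [PseudoMetricSpace X] (act : G → X → X) (F : Finset G) (x : X) (ε : ℝ) : Set X :=
  {y | ∀ g ∈ F, dist (act g x) (act g y) < ε}

/-- The closed dynamical (Bowen) ball of center `x` and radius `ε` over the finite set `F`. -/
def dynClosedBall [PseudoMetricSpace X] (act : G → X → X) (F : Finset G) (x : X) (ε : ℝ) :
    Set X :=
  {y | ∀ g ∈ F, dist (act g x) (act g y) ≤ ε}

/-- The packing pre-measure `P(Z, N, ε, s, {F_n})`: the supremum of `∑ᵢ exp (- s |F_{n_i}|)` over
all finite or countable pairwise disjoint families of closed Bowen balls with centers in `Z`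
and indices `n_i ≥ N`. -/
noncomputable def packP [PseudoMetricSpace X] (act : G → X → X) (Fs : ℕ → Finset G) (Z : Set X)
    (N : ℕ) (ε s : ℝ) : ℝ≥0∞ :=
  ⨆ (t : Set ℕ) (c : ℕ → X × ℕ) (_ : ∀ i ∈ t, (c i).1 ∈ Z ∧ N ≤ (c i).2)
    (_ : ∀ i ∈ t, ∀ j ∈ t, i ≠ j →
      Disjoint (dynClosedBall act (Fs (c i).2) (c i).1 ε)
        (dynClosedBall act (Fs (c j).2) (c j).1 ε)),
    ∑' i : t, ENNReal.ofReal (Real.exp (-s * ((Fs (c (i : ℕ)).2).card : ℝ)))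

/-- `P(Z, ε, s, {F_n}) = lim_{N → ∞} P(Z, N, ε, s, {F_n})`; the quantity is non-increasing
in `N`, so the limit equals the infimum. -/
noncomputable def packPLim [PseudoMetricSpace X] (act : G → X → X) (Fs : ℕ → Finset G)
    (Z : Set X) (ε s : ℝ) : ℝ≥0∞ :=
  ⨅ N : ℕ, packP act Fs Z N ε s

/-- `𝒫(Z, ε, s, {F_n})`: the countably subadditive envelope of `P(·, ε, s, {F_n})`. -/
noncomputable def packOuter [PseudoMetricSpace X] (act : G → X → X) (Fs : ℕ → Finset G)
    (Z : Set X) (ε s : ℝ) : ℝ≥0∞ :=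
  ⨅ (Zs : ℕ → Set X) (_ : Z ⊆ ⋃ i, Zs i), ∑' i, packPLim act Fs (Zs i) ε s

/-- `h^P_top(Z, ε, {F_n})`: the critical value of `s ≥ 0` at which `𝒫(Z, ε, s, {F_n})` jumps
from `+∞` to `0`. -/
noncomputable def packEntEps [PseudoMetricSpace X] (act : G → X → X) (Fs : ℕ → Finset G)
    (Z : Set X) (ε : ℝ) : ℝ≥0∞ :=
  ⨅ (s : ℝ≥0) (_ : packOuter act Fs Z ε (s : ℝ) = 0), (s : ℝ≥0∞)

/-- The amenable packing topological entropy
`h^P_top(Z, {F_n}) = lim_{ε → 0} h^P_top(Z, ε, {F_n})`. -/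
noncomputable def packEnt [PseudoMetricSpace X] (act : G → X → X) (Fs : ℕ → Finset G)
    (Z : Set X) : ℝ≥0∞ :=
  ⨆ (ε : ℝ) (_ : 0 < ε), packEntEps act Fs Z ε

/-- The Bowen pre-measure `ℳ(Z, N, ε, s, {F_n})`: the infimum of `∑ᵢ exp (- s |F_{n_i}|)` over
all finite or countable families of open Bowen balls with indices `n_i ≥ N` covering `Z`. -/
noncomputable def bowenM [PseudoMetricSpace X] (act : G → X → X) (Fs : ℕ → Finset G) (Z : Set X)
    (N : ℕ) (ε s : ℝ) : ℝ≥0∞ :=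
  ⨅ (t : Set ℕ) (c : ℕ → X × ℕ) (_ : ∀ i ∈ t, N ≤ (c i).2)
    (_ : Z ⊆ ⋃ i ∈ t, dynBall act (Fs (c i).2) (c i).1 ε),
    ∑' i : t, ENNReal.ofReal (Real.exp (-s * ((Fs (c (i : ℕ)).2).card : ℝ)))

/-- `ℳ(Z, s, {F_n}) = lim_{ε → 0} lim_{N → ∞} ℳ(Z, N, ε, s, {F_n})`. -/
noncomputable def bowenMLim [PseudoMetricSpace X] (act : G → X → X) (Fs : ℕ → Finset G)
    (Z : Set X) (s : ℝ) : ℝ≥0∞ :=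
  ⨆ (ε : ℝ) (_ : 0 < ε), ⨆ N : ℕ, bowenM act Fs Z N ε s

/-- The amenable Bowen topological entropy `h^B_top(Z, {F_n})`: the critical value of `s ≥ 0`
at which `ℳ(Z, s, {F_n})` jumps from `+∞` to `0`. -/
noncomputable def bowenEnt [PseudoMetricSpace X] (act : G → X → X) (Fs : ℕ → Finset G)
    (Z : Set X) : ℝ≥0∞ :=
  ⨅ (s : ℝ≥0) (_ : bowenMLim act Fs Z (s : ℝ) = 0), (s : ℝ≥0∞)

/-- `E` is an `(F, ε)`-separated set: distinct points are at `d_F`-distance `> ε`. -/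
def IsDynSeparated [PseudoMetricSpace X] (act : G → X → X) (F : Finset G) (ε : ℝ)
    (E : Set X) : Prop :=
  ∀ x ∈ E, ∀ y ∈ E, x ≠ y → ∃ g ∈ F, ε < dist (act g x) (act g y)

/-- `s_F(Z, ε)`: the maximal cardinality of an `(F, ε)`-separated subset of `Z`. -/
noncomputable def sepNum [PseudoMetricSpace X] (act : G → X → X) (F : Finset G) (Z : Set X)
    (ε : ℝ) : ℕ :=
  sSup {k : ℕ | ∃ E : Finset X, ↑E ⊆ Z ∧ IsDynSeparated act F ε ↑E ∧ E.card = k}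

/-- The upper capacity entropy of `Z` at scale `ε`:
`limsup_n (1/|F_n|) log s_{F_n}(Z, ε)`. -/
noncomputable def ucEntEps [PseudoMetricSpace X] (act : G → X → X) (Fs : ℕ → Finset G)
    (Z : Set X) (ε : ℝ) : ℝ≥0∞ :=
  limsup (fun n => ENNReal.ofReal (Real.log ((sepNum act (Fs n) Z ε : ℝ)) / ((Fs n).card : ℝ)))
    atTop

/-- The upper capacity topological entropy `h^{UC}_top(Z, {F_n})`. -/
noncomputable def ucEnt [PseudoMetricSpace X] (act : G → X → X) (Fs : ℕ → Finset G)
    (Z : Set X) : ℝ≥0∞ :=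
  ⨆ (ε : ℝ) (_ : 0 < ε), ucEntEps act Fs Z ε

/-- The upper local entropy `h̄^loc_μ(Z, {F_n}) =
`∫_Z lim_{ε→0} limsup_n -(1/|F_n|) log μ(B_{F_n}(x, ε)) dμ`. -/
noncomputable def upperLocalEnt [PseudoMetricSpace X] [MeasurableSpace X] (act : G → X → X)
    (Fs : ℕ → Finset G) (μ : Measure X) (Z : Set X) : ℝ≥0∞ :=
  ∫⁻ x in Z, ⨆ (ε : ℝ) (_ : 0 < ε),
    limsup (fun n =>
      ENNReal.ofReal (-Real.log ((μ (dynBall act (Fs n) x ε)).toReal) / ((Fs n).card : ℝ)))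
      atTop ∂μ

/-- A Følner sequence: a sequence of nonempty finite subsets of `G` which is asymptotically
invariant, i.e. `|g F_n ∆ F_n| / |F_n| → 0` for every `g ∈ G`. -/
def Folner [Group G] [DecidableEq G] (Fs : ℕ → Finset G) : Prop :=
  (∀ n, (Fs n).Nonempty) ∧
    ∀ g : G,
      Tendsto (fun n => ((((Fs n).image fun h => g * h) ∆ Fs n).card : ℝ) / ((Fs n).card : ℝ))
        atTop (nhds 0)

/-- A tempered sequence: `|⋃_{k < n} F_k⁻¹ F_n| ≤ C |F_n|` for a constant `C > 0`. -/
def Tempered [Group G] [DecidableEq G] (Fs : ℕ → Finset G) : Prop :=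
  ∃ C : ℝ, 0 < C ∧
    ∀ n : ℕ, ((((Finset.range n).biUnion fun k => (Fs k)⁻¹ * Fs n).card : ℝ))
      ≤ C * ((Fs n).card : ℝ)

/-- The growth condition `lim_n |F_n| / log n = +∞`. -/
def GrowthCond (Fs : ℕ → Finset G) [Group G] : Prop :=
  Tendsto (fun n => ((Fs n).card : ℝ) / Real.log (n : ℝ)) atTop atTop

/-- The static (Shannon) entropy of the finite measurable partition of `X` induced by a map
into a finite set. -/
noncomputable def partEnt [MeasurableSpace X] (μ : Measure X) {ι : Type*} [Fintype ι]
    (P : X → ι) : ℝ :=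
  ∑ i : ι, Real.negMulLog ((μ (P ⁻¹' {i})).toReal)

/-- The measure-theoretic (Kolmogorov–Sinai) entropy `h_μ(X, G)` of the action w.r.t. the
invariant measure `μ`, computed along the Følner sequence `{F_n}`: the supremum over finite
measurable partitions `P` of `lim_n (1/|F_n|) H_μ(⋁_{g ∈ F_n} (act g)⁻¹ P)`. -/
noncomputable def measEnt [MeasurableSpace X] [DecidableEq G] (act : G → X → X)
    (Fs : ℕ → Finset G) (μ : Measure X) : ℝ≥0∞ :=
  ⨆ (k : ℕ) (P : X → Fin k) (_ : Measurable P),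
    limsup (fun n => ENNReal.ofReal
      ((partEnt μ fun x (g : (Fs n : Finset G)) => P (act (g : G) x)) / ((Fs n).card : ℝ)))
      atTop

/-- The set of generic points of `μ` w.r.t. `{F_n}`. -/
def genericPoints [TopologicalSpace X] [MeasurableSpace X] (act : G → X → X)
    (Fs : ℕ → Finset G) (μ : Measure X) : Set X :=
  {x | ∀ f : C(X, ℝ),
    Tendsto (fun n => (∑ g ∈ Fs n, f (act g x)) / ((Fs n).card : ℝ)) atTop
      (nhds (∫ y, f y ∂μ))}

/-- `μ` is invariant under the action. -/
def InvariantMeasure [MeasurableSpace X] (act : G → X → X) (μ : Measure X) : Prop :=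
  ∀ (g : G) (s : Set X), MeasurableSet s → μ (act g ⁻¹' s) = μ s

/-- The action is ergodic w.r.t. `μ`: every invariant measurable set is null or conull. -/
def ErgodicAction [MeasurableSpace X] (act : G → X → X) (μ : Measure X) : Prop :=
  ∀ s : Set X, MeasurableSet s → (∀ g : G, act g ⁻¹' s = s) → μ s = 0 ∨ μ s = 1


section Sampling

/-- Lebesgue measure on the unit interval, the probability space on which measures on `X` are
realised as laws of random points. -/
noncomputable def unitMeasure : Measure ℝ := volume.restrict (Icc 0 1)

instance : IsProbabilityMeasure unitMeasure := ⟨by simp [unitMeasure]⟩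

theorem exists_measurable_subset_unitMeasure_eq {A : Set ℝ} (hA : MeasurableSet A) {c : ℝ≥0∞}
    (hc : c ≤ unitMeasure A) : ∃ B ⊆ A, MeasurableSet B ∧ unitMeasure B = c := by
  have hLip : LipschitzWith 1 fun t : ℝ => unitMeasure.real (A ∩ Iic t) := by
    refine LipschitzWith.of_le_add fun x y => ?_
    have hsub : A ∩ Iic x ⊆ (A ∩ Iic y) ∪ Ioc y x := by
      rintro z ⟨hzA, hzx⟩
      rcases le_or_gt z y with h | h
      · exact Or.inl ⟨hzA, h⟩
      · exact Or.inr ⟨h, hzx⟩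
    refine (measureReal_mono hsub).trans ((measureReal_union_le _ _).trans ?_)
    gcongr
    refine ENNReal.toReal_le_of_le_ofReal dist_nonneg ?_
    refine (Measure.restrict_apply_le _ _).trans ?_
    rw [Real.volume_Ioc, Real.dist_eq]
    exact ENNReal.ofReal_le_ofReal (le_abs_self _)
  have h0 : unitMeasure.real (A ∩ Iic 0) = 0 := by
    have : unitMeasure (A ∩ Iic 0) = 0 := by
      rw [unitMeasure, Measure.restrict_apply (hA.inter measurableSet_Iic)]
      refine measure_mono_null (t := {0}) ?_ (by simp)
      rintro z ⟨⟨-, hz⟩, hz'⟩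
      exact le_antisymm hz hz'.1
    simp [Measure.real, this]
  have h1 : unitMeasure.real (A ∩ Iic 1) = unitMeasure.real A := by
    have : unitMeasure (A ∩ Iic 1) = unitMeasure A := by
      rw [unitMeasure, Measure.restrict_apply (hA.inter measurableSet_Iic),
        Measure.restrict_apply hA]
      congr 1
      ext z
      constructor
      · exact fun h => ⟨h.1.1, h.2⟩
      · exact fun h => ⟨⟨h.1, h.2.2⟩, h.2⟩
    simp [Measure.real, this]
  have hcfin : c ≠ ∞ := ne_top_of_le_ne_top (measure_ne_top _ _) hc
  obtain ⟨t, -, ht⟩ := intermediate_value_Icc (zero_le_one' ℝ) hLip.continuous.continuousOn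
    (show c.toReal ∈ _ by
      simp only [h0, h1]
      exact ⟨ENNReal.toReal_nonneg, ENNReal.toReal_mono (measure_ne_top _ _) hc⟩)
  exact ⟨A ∩ Iic t, inter_subset_left, hA.inter measurableSet_Iic,
    (ENNReal.toReal_eq_toReal_iff' (measure_ne_top _ _) hcfin).1 ht⟩

/-- A set can be divided into measurable parts of measure at most `w i` as soon as its measure is
at most `∑ i, w i`. -/
theorem exists_simpleFunc_unitMeasure_fiber_le {ι : Type*} {J : Finset ι} (hJ : J.Nonempty)
    (w : ι → ℝ≥0∞) {A : Set ℝ} (hA : MeasurableSet A) (hw : unitMeasure A ≤ ∑ i ∈ J, w i) :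
    ∃ k : SimpleFunc ℝ ι, (∀ x, k x ∈ J) ∧ ∀ i ∈ J, unitMeasure (A ∩ k ⁻¹' {i}) ≤ w i := by
  induction hJ using Finset.Nonempty.cons_induction generalizing A with
  | singleton i =>
    refine ⟨SimpleFunc.const ℝ i, fun x => by simp, fun j hj => ?_⟩
    rw [Finset.mem_singleton] at hj
    subst hj
    exact (measure_mono inter_subset_left).trans (by simpa using hw)
  | cons i J hi hJ ih =>
    rcases le_total (unitMeasure A) (w i) with h | h
    · refine ⟨SimpleFunc.const ℝ i, fun x => by simp, fun j hj => ?_⟩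
      by_cases hij : j = i
      · subst hij
        exact (measure_mono inter_subset_left).trans h
      · have : A ∩ (SimpleFunc.const ℝ i) ⁻¹' {j} = ∅ := by
          ext x
          simp [Ne.symm hij]
        rw [this, measure_empty]
        exact bot_le
    · obtain ⟨B, hBA, hB, hBw⟩ := exists_measurable_subset_unitMeasure_eq hA h
      have hwfin : w i ≠ ∞ := ne_top_of_le_ne_top (measure_ne_top _ _) h
      obtain ⟨k, hkJ, hk⟩ := ih (hA.diff hB) (by
        rw [measure_sdiff hBA hB.nullMeasurableSet (measure_ne_top _ _), hBw]
        rw [Finset.sum_cons] at hw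
        exact tsub_le_iff_left.2 hw)
      refine ⟨SimpleFunc.piecewise B hB (SimpleFunc.const ℝ i) k, fun x => ?_, fun j hj => ?_⟩
      · rw [SimpleFunc.piecewise_apply]
        split_ifs
        · simp
        · exact Finset.mem_cons_of_mem (hkJ x)
      · rcases Finset.mem_cons.1 hj with rfl | hj
        · rw [← hBw]
          refine measure_mono ?_
          rintro x ⟨-, hx⟩
          by_contra hxB
          rw [mem_preimage, SimpleFunc.piecewise_apply, if_neg hxB, mem_singleton_iff] at hx
          exact hi (hx ▸ hkJ x)
        · refine (measure_mono ?_).trans (hk j hj)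
          rintro x ⟨hxA, hx⟩
          rw [mem_preimage, SimpleFunc.piecewise_apply, mem_singleton_iff] at hx
          split_ifs at hx with hxB
          · exact absurd ((show i = j from hx) ▸ hj) hi
          · exact ⟨⟨hxA, hxB⟩, hx⟩

end Sampling

section Refinement

variable {P : Type*} [MetricSpace X] [MetricSpace P]

/-- Every perturbation `h` of `g` of size at most `ρ` is such that, for all `ω ∈ D`, the Bowen
ball of radius `ε / 3` around `φ (h ω)` has small mass for the law of `φ ∘ h`, for some index
`n ≥ N`. -/
def RobustlyThin (act : G → X → X) (Fs : ℕ → Finset G) (φ : P → X) (s ε : ℝ) (N : ℕ)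
    (D : Set ℝ) (g : ℝ → P) (ρ : ℝ) : Prop :=
  ∀ h : ℝ → P, (∀ ω, dist (h ω) (g ω) ≤ ρ) → ∀ ω ∈ D, ∃ n ≥ N,
    unitMeasure {ω' | φ (h ω') ∈ dynBall act (Fs n) (φ (h ω)) (ε / 3)} ≤
      ENNReal.ofReal (Real.exp (-s * ((Fs n).card : ℝ)))

theorem RobustlyThin.perturb {act : G → X → X} {Fs : ℕ → Finset G} {φ : P → X} {s ε : ℝ} {N : ℕ}
    {D : Set ℝ} {g g' : ℝ → P} {ρ ρ' r : ℝ} (H : RobustlyThin act Fs φ s ε N D g ρ)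
    (hg : ∀ ω, dist (g' ω) (g ω) ≤ r) (hρ : ρ' + r ≤ ρ) :
    RobustlyThin act Fs φ s ε N D g' ρ' := fun h hh =>
  H h fun ω => (dist_triangle _ (g' ω) _).trans ((add_le_add (hh ω) (hg ω)).trans hρ)

/-- A continuous action moves Bowen distances little when points of a finite set are moved
little. -/
theorem exists_perturbation_bound {act : G → X → X} (hact : ∀ g, Continuous (act g)) {φ : P → X}
    (hφ : Continuous φ) (T : Finset G) (S : Finset P) {η : ℝ} (hη : 0 < η) :
    ∃ ρ > 0, ∀ p ∈ S, ∀ q, dist q p ≤ ρ → ∀ γ ∈ T, dist (act γ (φ q)) (act γ (φ p)) < η := by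
  have h : ∀ᶠ ρ in 𝓝[>] (0 : ℝ), ∀ p ∈ S, ∀ γ ∈ T, ∀ q, dist q p ≤ ρ →
      dist (act γ (φ q)) (act γ (φ p)) < η := by
    rw [Filter.eventually_all_finset]
    intro p _
    rw [Filter.eventually_all_finset]
    intro γ _
    obtain ⟨δ, hδ, H⟩ := Metric.continuous_iff.1 ((hact γ).comp hφ) p η hη
    filter_upwards [Ioo_mem_nhdsGT hδ] with ρ hρ q hq
    exact H q (hq.trans_lt hρ.2)
  obtain ⟨ρ, hρ, hρ0⟩ := (h.and self_mem_nhdsWithin).exists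
  exact ⟨ρ, hρ0, fun p hp q hq γ hγ => hρ p hp γ hγ q hq⟩

theorem mem_dynClosedBall_self (act : G → X → X) (F : Finset G) (x : X) {ε : ℝ} (hε : 0 ≤ ε) :
    x ∈ dynClosedBall act F x ε := fun g _ => by simpa using hε

/-- A finite family of disjoint Bowen balls of large total weight keeps total weight at least `1`
after removal of the balls meeting a given finite set. -/
theorem exists_subfamily_avoiding {act : G → X → X} {Fs : ℕ → Finset G} {s ε : ℝ} (hs : 0 ≤ s)
    {A : Set X} {N : ℕ} (hA : packP act Fs A N ε s = ∞) (S : Finset X) :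
    ∃ (J : Finset ℕ) (c : ℕ → X × ℕ), (∀ i ∈ J, (c i).1 ∈ A ∧ N ≤ (c i).2) ∧
      (∀ i ∈ J, ∀ j ∈ J, i ≠ j → Disjoint (dynClosedBall act (Fs (c i).2) (c i).1 ε)
        (dynClosedBall act (Fs (c j).2) (c j).1 ε)) ∧
      (∀ i ∈ J, ∀ x ∈ S, x ∉ dynClosedBall act (Fs (c i).2) (c i).1 ε) ∧
      1 ≤ ∑ i ∈ J, ENNReal.ofReal (Real.exp (-s * ((Fs (c i).2).card : ℝ))) := by
  classical
  have hlt : (1 + S.card : ℝ≥0∞) < packP act Fs A N ε s := by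
    rw [hA]
    exact ENNReal.add_lt_top.2 ⟨ENNReal.one_lt_top, ENNReal.natCast_lt_top _⟩
  simp only [packP, lt_iSup_iff] at hlt
  obtain ⟨t, c, hc, hd, hsum⟩ := hlt
  rw [ENNReal.tsum_eq_iSup_sum, lt_iSup_iff] at hsum
  obtain ⟨I, hI⟩ := hsum
  set w : ℕ → ℝ≥0∞ := fun i => ENNReal.ofReal (Real.exp (-s * ((Fs (c i).2).card : ℝ)))
  have hw : ∀ i, w i ≤ 1 := fun i => by
    rw [← ENNReal.ofReal_one]
    refine ENNReal.ofReal_le_ofReal (Real.exp_le_one_iff.2 ?_)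
    rw [neg_mul]
    exact neg_nonpos.2 (by positivity)
  set I' : Finset ℕ := I.map (Function.Embedding.subtype _)
  have hI't : ∀ i ∈ I', i ∈ t := by
    intro i hi
    obtain ⟨j, -, rfl⟩ := Finset.mem_map.1 hi
    exact j.2
  have hI' : (1 + S.card : ℝ≥0∞) < ∑ i ∈ I', w i := by
    rw [Finset.sum_map]
    exact hI
  set bad : ℕ → Prop := fun i => ∃ x ∈ S, x ∈ dynClosedBall act (Fs (c i).2) (c i).1 ε
  have hcard : (I'.filter bad).card ≤ S.card := by
    have hb : ∀ i : ℕ, ∃ x, bad i → x ∈ S ∧ x ∈ dynClosedBall act (Fs (c i).2) (c i).1 ε := by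
      intro i
      by_cases h : bad i
      · obtain ⟨x, hx⟩ := h
        exact ⟨x, fun _ => hx⟩
      · exact ⟨(c i).1, fun h' => absurd h' h⟩
    choose x hx using hb
    refine Finset.card_le_card_of_injOn x (fun i hi => ?_) fun i hi j hj hij => ?_
    · exact (hx i (Finset.mem_filter.1 hi).2).1
    · by_contra hne
      have hi' := Finset.mem_filter.1 hi
      have hj' := Finset.mem_filter.1 hj
      exact Set.disjoint_left.1 (hd i (hI't i hi'.1) j (hI't j hj'.1) hne) (hx i hi'.2).2
        (hij ▸ (hx j hj'.2).2)
  have hbad : ∑ i ∈ I'.filter bad, w i ≤ S.card := by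
    refine (Finset.sum_le_card_nsmul _ _ 1 fun i _ => hw i).trans ?_
    rw [nsmul_one]
    exact_mod_cast hcard
  refine ⟨I'.filter fun i => ¬ bad i, c, fun i hi => hc i (hI't i (Finset.mem_filter.1 hi).1),
    fun i hi j hj => hd i (hI't i (Finset.mem_filter.1 hi).1) j (hI't j (Finset.mem_filter.1 hj).1),
    fun i hi x hx hxi => (Finset.mem_filter.1 hi).2 ⟨x, hx, hxi⟩, ?_⟩
  rw [← Finset.sum_filter_not_add_sum_filter I' bad] at hI'
  have h2 : (1 + S.card : ℝ≥0∞) ≤ (∑ i ∈ I'.filter fun i => ¬ bad i, w i) + S.card :=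
    hI'.le.trans (by gcongr)
  exact (ENNReal.add_le_add_iff_right (ENNReal.natCast_ne_top _)).1 h2

/-- Spreading out the mass that a simple random point `f` puts at `p`. -/
theorem exists_robustlyThin_fiber {act : G → X → X} (hact : ∀ g, Continuous (act g))
    {Fs : ℕ → Finset G} {φ : P → X} (hφ : Continuous φ) {s ε : ℝ} (hs : 0 ≤ s) (hε : 0 < ε)
    (H : ∀ U : Set P, IsOpen U → U.Nonempty → ∀ N, packP act Fs (φ '' U) N ε s = ∞)
    (N : ℕ) (f : SimpleFunc ℝ P) (p : P) {r : ℝ} (hr : 0 < r) :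
    ∃ g : SimpleFunc ℝ P, (∀ ω, dist (g ω) (f ω) < r) ∧ (∀ ω, f ω ≠ p → g ω = f ω) ∧
      ∃ ρ > 0, RobustlyThin act Fs φ s ε N (f ⁻¹' {p}) g ρ := by
  classical
  obtain ⟨J, c, hcJ, hdJ, hSJ, hsum⟩ := exists_subfamily_avoiding hs
    (H (Metric.ball p r) Metric.isOpen_ball ⟨p, Metric.mem_ball_self hr⟩ N) (f.range.image φ)
  have hy : ∀ i, ∃ y, i ∈ J → y ∈ Metric.ball p r ∧ φ y = (c i).1 := by
    intro i
    by_cases hi : i ∈ J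
    · obtain ⟨y, hy⟩ := (hcJ i hi).1
      exact ⟨y, fun _ => hy⟩
    · exact ⟨p, fun h => absurd h hi⟩
  choose y hy using hy
  set w : ℕ → ℝ≥0∞ := fun i => ENNReal.ofReal (Real.exp (-s * ((Fs (c i).2).card : ℝ)))
  have hJ : J.Nonempty := by
    rw [Finset.nonempty_iff_ne_empty]
    rintro rfl
    simp at hsum
  have hA : MeasurableSet (f ⁻¹' {p}) := f.measurableSet_fiber p
  obtain ⟨k, hkJ, hk⟩ := exists_simpleFunc_unitMeasure_fiber_le hJ w hA (prob_le_one.trans hsum)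
  set g : SimpleFunc ℝ P := SimpleFunc.piecewise (f ⁻¹' {p}) hA (k.map y) f
  have hg1 : ∀ ω, f ω = p → g ω = y (k ω) := fun ω hω => by
    rw [SimpleFunc.piecewise_apply, if_pos (by simpa using hω), SimpleFunc.map_apply]
  have hg2 : ∀ ω, f ω ≠ p → g ω = f ω := fun ω hω => by
    rw [SimpleFunc.piecewise_apply, if_neg (by simpa using hω)]
  obtain ⟨ρ, hρ, hρg⟩ := exists_perturbation_bound hact hφ
    (J.biUnion fun i => Fs (c i).2) g.range (η := ε / 3) (by positivity)
  refine ⟨g, fun ω => ?_, hg2, ρ, hρ, fun h hh ω hω => ?_⟩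
  · by_cases hω : f ω = p
    · rw [hg1 ω hω, hω]
      exact (hy _ (hkJ ω)).1
    · rw [hg2 ω hω, dist_self]
      exact hr
  · have hω : f ω = p := hω
    have hi := hkJ ω
    refine ⟨(c (k ω)).2, (hcJ _ hi).2, (measure_mono ?_).trans (hk (k ω) hi)⟩
    intro ω' hω'
    have hmem : φ (g ω') ∈ dynClosedBall act (Fs (c (k ω)).2) (c (k ω)).1 ε := by
      intro γ hγ
      have hγ' : γ ∈ J.biUnion fun i => Fs (c i).2 := Finset.mem_biUnion.2 ⟨_, hi, hγ⟩
      have e1 := hρg (g ω) (SimpleFunc.mem_range_self _ _) (h ω) (hh ω) γ hγ'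
      have e2 := hρg (g ω') (SimpleFunc.mem_range_self _ _) (h ω') (hh ω') γ hγ'
      have e3 : dist (act γ (φ (h ω))) (act γ (φ (h ω'))) < ε / 3 := hω' γ hγ
      have e4 : φ (g ω) = (c (k ω)).1 := by rw [hg1 ω hω]; exact (hy _ hi).2
      rw [← e4]
      have e5 := dist_triangle4 (act γ (φ (g ω))) (act γ (φ (h ω))) (act γ (φ (h ω')))
        (act γ (φ (g ω')))
      rw [dist_comm (act γ (φ (g ω))) (act γ (φ (h ω)))] at e5
      linarith
    by_cases hfω' : f ω' = p
    · refine ⟨hfω', ?_⟩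
      by_contra hne
      have hj := hkJ ω'
      rw [hg1 ω' hfω', (hy _ hj).2] at hmem
      exact Set.disjoint_left.1 (hdJ _ hj _ hi hne)
        (mem_dynClosedBall_self act _ _ hε.le) hmem
    · rw [hg2 ω' hfω'] at hmem
      exact absurd hmem (hSJ _ hi _ (Finset.mem_image_of_mem φ (SimpleFunc.mem_range_self _ _)))

theorem exists_robustlyThin {act : G → X → X} (hact : ∀ g, Continuous (act g))
    {Fs : ℕ → Finset G} {φ : P → X} (hφ : Continuous φ) {s ε : ℝ} (hs : 0 ≤ s) (hε : 0 < ε)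
    (H : ∀ U : Set P, IsOpen U → U.Nonempty → ∀ N, packP act Fs (φ '' U) N ε s = ∞)
    (N : ℕ) (f : SimpleFunc ℝ P) {r : ℝ} (hr : 0 < r) :
    ∃ g : SimpleFunc ℝ P, (∀ ω, dist (g ω) (f ω) ≤ r) ∧
      ∃ ρ > 0, RobustlyThin act Fs φ s ε N univ g ρ := by
  classical
  have key : ∀ S : Finset P, ∀ r > 0, ∃ g : SimpleFunc ℝ P, (∀ ω, dist (g ω) (f ω) < r) ∧
      (∀ ω, f ω ∉ S → g ω = f ω) ∧
      ∃ ρ > 0, RobustlyThin act Fs φ s ε N (f ⁻¹' (S : Set P)) g ρ := by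
    intro S
    induction S using Finset.induction_on with
    | empty =>
      intro r hr
      exact ⟨f, fun ω => by simpa using hr, fun _ _ => rfl, 1, one_pos, fun h _ ω hω => by
        simp at hω⟩
    | insert p S hp ih =>
      intro r hr
      obtain ⟨g, hgf, hgS, ρ, hρ, hR⟩ := ih (r / 2) (half_pos hr)
      obtain ⟨g', hg'g, hg'p, ρ', hρ', hR'⟩ := exists_robustlyThin_fiber hact hφ hs hε H N g p
        (r := min (r / 2) (ρ / 2)) (by positivity)
      refine ⟨g', fun ω => ?_, fun ω hω => ?_, min ρ' (ρ / 2), by positivity, ?_⟩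
      · have h1 := dist_triangle (g' ω) (g ω) (f ω)
        have h2 := (hg'g ω).trans_le (min_le_left _ _)
        have h3 := hgf ω
        linarith
      · rw [Finset.mem_insert, not_or] at hω
        have h1 := hgS ω hω.2
        rw [hg'p ω (h1 ▸ hω.1), h1]
      · intro h hh ω hω
        by_cases hS : f ω ∈ S
        · refine hR.perturb (ρ' := ρ / 2) (r := ρ / 2)
            (fun ω => ((hg'g ω).trans_le (min_le_right _ _)).le) (by linarith) h
            (fun ω => (hh ω).trans (min_le_right _ _)) ω hS
        · refine hR' h (fun ω => (hh ω).trans (min_le_left _ _)) ω ?_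
          have hfp : f ω = p := by
            have : f ω ∈ insert p S := hω
            exact (Finset.mem_insert.1 this).resolve_right hS
          simpa [hgS ω hS] using hfp
  obtain ⟨g, hg, -, ρ, hρ, hR⟩ := key f.range r hr
  refine ⟨g, fun ω => (hg ω).le, ρ, hρ, fun h hh ω _ => hR h hh ω ?_⟩
  exact SimpleFunc.mem_range_self f ω

/-- If every nonempty open set has infinite packing pre-measure, then there is a random point
all of whose values are infinitely often centres of Bowen balls of small mass. -/
theorem exists_random_point [CompleteSpace P] [Nonempty P] [MeasurableSpace X] [BorelSpace X]
    {act : G → X → X} (hact : ∀ g, Continuous (act g))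
    {Fs : ℕ → Finset G} {φ : P → X} (hφ : Continuous φ) {s ε : ℝ} (hs : 0 ≤ s) (hε : 0 < ε)
    (H : ∀ U : Set P, IsOpen U → U.Nonempty → ∀ N, packP act Fs (φ '' U) N ε s = ∞) :
    ∃ f : ℝ → P, Measurable (φ ∘ f) ∧ ∀ ω, ∀ N, ∃ n ≥ N,
      unitMeasure {ω' | φ (f ω') ∈ dynBall act (Fs n) (φ (f ω)) (ε / 3)} ≤
        ENNReal.ofReal (Real.exp (-s * ((Fs n).card : ℝ))) := by
  have step : ∀ (N : ℕ) (a : SimpleFunc ℝ P × {ρ : ℝ // 0 < ρ}),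
      ∃ b : SimpleFunc ℝ P × {ρ : ℝ // 0 < ρ}, (∀ ω, dist (b.1 ω) (a.1 ω) ≤ a.2 / 2) ∧
        (b.2 : ℝ) ≤ a.2 / 2 ∧ RobustlyThin act Fs φ s ε N univ b.1 b.2 := by
    rintro N ⟨f, ρ, hρ⟩
    obtain ⟨g, hg, ρ', hρ', hR⟩ := exists_robustlyThin hact hφ hs hε H N f (half_pos hρ)
    refine ⟨⟨g, min ρ' (ρ / 2), by positivity⟩, hg, min_le_right _ _, fun h hh => ?_⟩
    exact hR h fun ω => (hh ω).trans (min_le_left _ _)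
  choose next hnext1 hnext2 hnext3 using step
  obtain ⟨p₀⟩ := ‹Nonempty P›
  let a : ℕ → SimpleFunc ℝ P × {ρ : ℝ // 0 < ρ} := fun n =>
    Nat.rec (SimpleFunc.const ℝ p₀, ⟨1, one_pos⟩) (fun k b => next k b) n
  have ha : ∀ n, a (n + 1) = next n (a n) := fun n => rfl
  have hρ : ∀ n, ((a n).2 : ℝ) ≤ (1 / 2) ^ n := by
    intro n
    induction n with
    | zero => simp [a]
    | succ n ih =>
      rw [ha, pow_succ]
      have := hnext2 n (a n)
      linarith
  have hdist : ∀ n m, ∀ ω, dist ((a (n + m)).1 ω) ((a n).1 ω) ≤ (a n).2 - (a (n + m)).2 := by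
    intro n m ω
    induction m with
    | zero => simp
    | succ m ih =>
      have h1 := dist_triangle ((a (n + (m + 1))).1 ω) ((a (n + m)).1 ω) ((a n).1 ω)
      have h2 := hnext1 (n + m) (a (n + m)) ω
      have h3 := hnext2 (n + m) (a (n + m))
      rw [← ha (n + m), add_assoc] at h2 h3
      linarith
  have hcauchy : ∀ ω, CauchySeq fun n => (a n).1 ω := by
    intro ω
    refine cauchySeq_of_le_tendsto_0' (fun n => (1 / 2 : ℝ) ^ n) (fun n m hnm => ?_)
      (tendsto_pow_atTop_nhds_zero_of_lt_one (by norm_num) (by norm_num))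
    obtain ⟨k, rfl⟩ := Nat.exists_eq_add_of_le hnm
    rw [dist_comm]
    have := hdist n k ω
    have := (a (n + k)).2.2
    have := hρ n
    linarith
  choose f hf using fun ω => cauchySeq_tendsto_of_complete (hcauchy ω)
  refine ⟨f, ?_, fun ω N => ?_⟩
  · refine measurable_of_tendsto_metrizable (f := fun n => φ ∘ (a n).1) (fun n => ?_) ?_
    · exact ((a n).1.map φ).measurable
    · rw [tendsto_pi_nhds]
      exact fun ω => (hφ.tendsto _).comp (hf ω)
  · refine hnext3 N (a N) f (fun ω => ?_) ω (mem_univ _)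
    rw [← ha]
    refine le_of_tendsto ((hf ω).dist tendsto_const_nhds) ?_
    filter_upwards [eventually_ge_atTop (N + 1)] with m hm
    obtain ⟨k, rfl⟩ := Nat.exists_eq_add_of_le hm
    have := hdist (N + 1) k ω
    have := (a (N + 1 + k)).2.2
    linarith

end Refinement

/-- Removing the largest open set with null image leaves a closed set all of whose nonempty
relatively open parts have positive image. -/
theorem exists_isClosed_locally_pos {P : Type*} [TopologicalSpace P] [SecondCountableTopology P]
    (m : OuterMeasure X) {φ : P → X} (h : m (range φ) ≠ 0) :
    ∃ Q : Set P, IsClosed Q ∧ Q.Nonempty ∧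
      ∀ U : Set P, IsOpen U → (U ∩ Q).Nonempty → m (φ '' (U ∩ Q)) ≠ 0 := by
  set b := TopologicalSpace.countableBasis P
  have hb := TopologicalSpace.isBasis_countableBasis P
  set C : Set (Set P) := {V ∈ b | m (φ '' V) = 0}
  have hC : C.Countable := (TopologicalSpace.countable_countableBasis P).mono fun V hV => hV.1
  have hnull : m (φ '' ⋃₀ C) = 0 := by
    rw [sUnion_eq_biUnion, image_iUnion₂]
    exact (measure_biUnion_null_iff hC).2 fun V hV => hV.2
  have key : ∀ A : Set P, m (φ '' (A ∩ (⋃₀ C)ᶜ)) = 0 → m (φ '' A) = 0 := by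
    intro A hA
    refine measure_mono_null ?_ (measure_union_null hA hnull)
    rw [← image_union]
    refine image_mono fun x hx => ?_
    by_cases hxC : x ∈ ⋃₀ C
    · exact Or.inr hxC
    · exact Or.inl ⟨hx, hxC⟩
  refine ⟨(⋃₀ C)ᶜ, ?_, ?_, ?_⟩
  · exact (isOpen_sUnion fun V hV => hb.isOpen hV.1).isClosed_compl
  · rw [Set.nonempty_iff_ne_empty]
    intro he
    refine h ?_
    rw [← image_univ]
    exact key _ (by simp [he])
  · rintro U hU ⟨x, hxU, hxC⟩ h0
    obtain ⟨V, hV, hxV, hVU⟩ := hb.exists_subset_of_mem_open hxU hU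
    exact hxC ⟨V, ⟨hV, measure_mono_null (image_mono hVU) (key U h0)⟩, hxV⟩

section Packing

variable [MetricSpace X]

theorem packP_mono (act : G → X → X) (Fs : ℕ → Finset G) {A B : Set X} (h : A ⊆ B) (N : ℕ)
    (ε s : ℝ) : packP act Fs A N ε s ≤ packP act Fs B N ε s :=
  iSup_mono fun _ => iSup_mono fun _ => iSup_mono' fun hc =>
    ⟨fun i hi => ⟨h (hc i hi).1, (hc i hi).2⟩, le_rfl⟩

theorem packPLim_empty (act : G → X → X) (Fs : ℕ → Finset G) (ε s : ℝ) :
    packPLim act Fs ∅ ε s = 0 := by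
  refine le_antisymm (iInf_le_of_le 0 (iSup₂_le fun t c => iSup₂_le fun hc _ => ?_)) bot_le
  have : IsEmpty t := ⟨fun i => (hc i i.2).1⟩
  simp

/-- The packing set function `packOuter`, as an outer measure. -/
noncomputable def packOuterMeasure (act : G → X → X) (Fs : ℕ → Finset G) (ε s : ℝ) :
    OuterMeasure X :=
  OuterMeasure.ofFunction (fun A => packPLim act Fs A ε s) (packPLim_empty act Fs ε s)

theorem packOuterMeasure_apply (act : G → X → X) (Fs : ℕ → Finset G) (ε s : ℝ) (A : Set X) :
    packOuterMeasure act Fs ε s A = packOuter act Fs A ε s := rfl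

theorem summable_exp_neg_card [Group G] {Fs : ℕ → Finset G} (hgrow : GrowthCond Fs) {δ : ℝ}
    (hδ : 0 < δ) : Summable fun n => Real.exp (-δ * ((Fs n).card : ℝ)) := by
  have hev : ∀ᶠ n : ℕ in atTop, Real.exp (-δ * ((Fs n).card : ℝ)) ≤ 1 / (n : ℝ) ^ 2 := by
    filter_upwards [hgrow.eventually_ge_atTop (2 / δ), eventually_ge_atTop 2] with n hn hn2
    have hn1 : (1 : ℝ) < n := by exact_mod_cast hn2
    have hlog : 0 < Real.log n := Real.log_pos hn1
    rw [le_div_iff₀ hlog, div_mul_eq_mul_div, div_le_iff₀ hδ] at hn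
    rw [one_div, ← Real.exp_log (show (0 : ℝ) < n by linarith), ← Real.exp_nat_mul,
      ← Real.exp_neg]
    refine Real.exp_le_exp.2 ?_
    push_cast
    linarith
  refine Summable.of_norm_bounded_eventually_nat
    (Real.summable_one_div_nat_pow.2 one_lt_two) ?_
  filter_upwards [hev] with n hn
  rwa [Real.norm_of_nonneg (Real.exp_nonneg _)]

theorem ofReal_exp_split (s t x : ℝ) : ENNReal.ofReal (Real.exp (-t * x)) =
    ENNReal.ofReal (Real.exp (-(t - s) * x)) * ENNReal.ofReal (Real.exp (-s * x)) := by
  rw [← ENNReal.ofReal_mul (Real.exp_nonneg _), ← Real.exp_add]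
  congr 2
  ring

theorem packOuter_eq_zero_of_packP_ne_top [Group G] (act : G → X → X) {Fs : ℕ → Finset G}
    (hgrow : GrowthCond Fs) {A : Set X} {N : ℕ} {ε s t : ℝ} (hst : s < t)
    (h : packP act Fs A N ε s ≠ ∞) : packOuter act Fs A ε t = 0 := by
  have hlim : Tendsto (fun n => ENNReal.ofReal (Real.exp (-(t - s) * ((Fs n).card : ℝ)))) atTop
      (𝓝 0) := by
    rw [← ENNReal.ofReal_zero]
    exact ENNReal.tendsto_ofReal
      (summable_exp_neg_card hgrow (sub_pos.2 hst)).tendsto_atTop_zero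
  have hle : ∀ η : ℝ≥0∞, 0 < η → packPLim act Fs A ε t ≤ η * packP act Fs A N ε s := by
    intro η hη
    obtain ⟨N', hN'⟩ := eventually_atTop.1 (hlim.eventually (gt_mem_nhds hη))
    refine iInf_le_of_le (max N N') (iSup₂_le fun T c => iSup₂_le fun hc hd => ?_)
    calc ∑' i : T, ENNReal.ofReal (Real.exp (-t * ((Fs (c (i : ℕ)).2).card : ℝ)))
        ≤ ∑' i : T, η * ENNReal.ofReal (Real.exp (-s * ((Fs (c (i : ℕ)).2).card : ℝ))) := by
          refine ENNReal.tsum_le_tsum fun i => ?_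
          rw [ofReal_exp_split s t]
          gcongr
          exact (hN' _ ((le_max_right _ _).trans (hc i i.2).2)).le
      _ = η * ∑' i : T, ENNReal.ofReal (Real.exp (-s * ((Fs (c (i : ℕ)).2).card : ℝ))) :=
          ENNReal.tsum_mul_left
      _ ≤ η * packP act Fs A N ε s := by
          gcongr
          exact le_iSup₂_of_le T c (le_iSup₂_of_le
            (fun i hi => ⟨(hc i hi).1, (le_max_left _ _).trans (hc i hi).2⟩) hd le_rfl)
  have h0 : packPLim act Fs A ε t ≤ 0 := by
    have ht : Tendsto (fun η : ℝ≥0∞ => η * packP act Fs A N ε s) (𝓝[>] 0) (𝓝 0) := by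
      have := ENNReal.Tendsto.mul_const (tendsto_id (x := 𝓝 (0 : ℝ≥0∞))) (Or.inr h)
      rw [zero_mul] at this
      exact this.mono_left nhdsWithin_le_nhds
    refine ge_of_tendsto ht ?_
    filter_upwards [self_mem_nhdsWithin] with η hη using hle η hη
  rw [← packOuterMeasure_apply]
  exact le_antisymm ((OuterMeasure.ofFunction_le A).trans h0) bot_le

end Packing

section DynBall

variable [MetricSpace X] {act : G → X → X}

theorem isOpen_dynBall (hact : ∀ g, Continuous (act g)) (F : Finset G) (x : X) (ε : ℝ) :
    IsOpen (dynBall act F x ε) := by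
  have : dynBall act F x ε = ⋂ g ∈ F, {y | dist (act g x) (act g y) < ε} := by
    ext y
    simp [dynBall]
  rw [this]
  exact isOpen_biInter_finset fun g _ =>
    isOpen_lt (continuous_const.dist (hact g)) continuous_const

theorem mem_dynBall_self (act : G → X → X) (F : Finset G) (x : X) {ε : ℝ} (hε : 0 < ε) :
    x ∈ dynBall act F x ε := fun g _ => by simpa using hε

theorem dynBall_mono (act : G → X → X) (F : Finset G) (x : X) {ε ε' : ℝ} (h : ε ≤ ε') :
    dynBall act F x ε ⊆ dynBall act F x ε' := fun _ hy g hg => (hy g hg).trans_le h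

theorem measurable_measure_dynBall [SecondCountableTopology X] [MeasurableSpace X] [BorelSpace X]
    (hact : ∀ g, Continuous (act g)) (μ : Measure X) [SFinite μ] (F : Finset G) (ε : ℝ) :
    Measurable fun x => μ (dynBall act F x ε) := by
  have hopen : IsOpen {p : X × X | ∀ g ∈ F, dist (act g p.1) (act g p.2) < ε} := by
    have : {p : X × X | ∀ g ∈ F, dist (act g p.1) (act g p.2) < ε} =
        ⋂ g ∈ F, {p : X × X | dist (act g p.1) (act g p.2) < ε} := by
      ext y
      simp
    rw [this]
    exact isOpen_biInter_finset fun g _ =>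
      isOpen_lt (((hact g).comp continuous_fst).dist ((hact g).comp continuous_snd))
        continuous_const
  exact measurable_measure_prodMk_left hopen.measurableSet

end DynBall

section VariationalPrinciple

variable [MetricSpace X] [SecondCountableTopology X] [MeasurableSpace X]

/-- A set of centres of Bowen balls of small mass contains many disjoint Bowen balls. -/
theorem measure_le_mul_packP {act : G → X → X} (hact : ∀ g, Continuous (act g))
    (Fs : ℕ → Finset G) (μ : Measure X) {A : Set X} {N n : ℕ} (hn : N ≤ n) {ε r : ℝ}
    (hε : 0 < ε) (s : ℝ)
    (hA : ∀ x ∈ A, μ (dynBall act (Fs n) x ε) ≤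
      ENNReal.ofReal (Real.exp (-r * ((Fs n).card : ℝ)))) :
    μ A ≤ ENNReal.ofReal (Real.exp (-(r - s) * ((Fs n).card : ℝ))) *
      packP act Fs A N (ε / 4) s := by
  rcases A.eq_empty_or_nonempty with rfl | ⟨x₀, -⟩
  · simp
  have : Nonempty X := ⟨x₀⟩
  obtain ⟨u, huA, hud, hu⟩ := Vitali.exists_disjoint_subfamily_covering_enlargement
    (fun x => dynClosedBall act (Fs n) x (ε / 4)) A (fun _ => 1) 2 one_lt_two
    (fun _ _ => zero_le_one) 1 (fun _ _ => le_rfl)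
    (fun x _ => ⟨x, mem_dynClosedBall_self act _ x (by positivity)⟩)
  have hucount : u.Countable := by
    refine hud.countable_of_nonempty_interior fun x _ => ⟨x, ?_⟩
    exact mem_interior.2 ⟨dynBall act (Fs n) x (ε / 4), fun y hy g hg => (hy g hg).le,
      isOpen_dynBall hact _ _ _, mem_dynBall_self act _ _ (by positivity)⟩
  have hcover : A ⊆ ⋃ x ∈ u, dynBall act (Fs n) x ε := by
    intro a ha
    obtain ⟨b, hb, ⟨z, hza, hzb⟩, -⟩ := hu a ha
    refine mem_biUnion hb fun g hg => ?_
    have h1 := dist_triangle_right (act g b) (act g a) (act g z)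
    have h2 := hza g hg
    have h3 := hzb g hg
    linarith
  obtain ⟨e, he⟩ := Set.countable_iff_exists_injOn.1 hucount
  have hpack : ∑' _ : u, ENNReal.ofReal (Real.exp (-s * ((Fs n).card : ℝ))) ≤
      packP act Fs A N (ε / 4) s := by
    have hinv : ∀ x ∈ u, Function.invFunOn e u (e x) = x := fun x hx =>
      he.leftInvOn_invFunOn hx
    rw [← (Equiv.Set.imageOfInjOn e u he).symm.tsum_eq]
    refine le_iSup₂_of_le (e '' u) (fun j => (Function.invFunOn e u j, n))
      (le_iSup₂_of_le ?_ ?_ le_rfl)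
    · rintro _ ⟨x, hx, rfl⟩
      exact ⟨by simpa [hinv x hx] using huA hx, hn⟩
    · rintro _ ⟨x, hx, rfl⟩ _ ⟨y, hy, rfl⟩ hxy
      simp only [hinv x hx, hinv y hy]
      exact hud hx hy fun h => hxy (h ▸ rfl)
  calc μ A ≤ ∑' x : u, μ (dynBall act (Fs n) x ε) :=
        (measure_mono hcover).trans (measure_biUnion_le μ hucount _)
    _ ≤ ∑' _ : u, ENNReal.ofReal (Real.exp (-r * ((Fs n).card : ℝ))) :=
        ENNReal.tsum_le_tsum fun x => hA x (huA x.2)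
    _ = ENNReal.ofReal (Real.exp (-(r - s) * ((Fs n).card : ℝ))) *
          ∑' _ : u, ENNReal.ofReal (Real.exp (-s * ((Fs n).card : ℝ))) := by
        rw [← ENNReal.tsum_mul_left]
        simp_rw [ofReal_exp_split s r]
    _ ≤ _ := by gcongr

theorem le_packEntEps_of_frequently [Group G] {act : G → X → X} (hact : ∀ g, Continuous (act g))
    {Fs : ℕ → Finset G} (hgrow : GrowthCond Fs) (μ : Measure X) [IsFiniteMeasure μ] {Z : Set X}
    {r : ℝ≥0} {ε : ℝ} (hε : 0 < ε)
    (h : μ {x ∈ Z | ∃ᶠ n in atTop, μ (dynBall act (Fs n) x ε) ≤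
      ENNReal.ofReal (Real.exp (-r * ((Fs n).card : ℝ)))} ≠ 0) :
    (r : ℝ≥0∞) ≤ packEntEps act Fs Z (ε / 4) := by
  refine le_iInf₂ fun s hs => ?_
  by_contra! hsr
  have hsr : (s : ℝ) < r := by exact_mod_cast hsr
  obtain ⟨Zs, hZs, hsum⟩ : ∃ Zs : ℕ → Set X, Z ⊆ ⋃ i, Zs i ∧
      ∑' i, packPLim act Fs (Zs i) (ε / 4) s < 1 := by
    have : packOuter act Fs Z (ε / 4) s < 1 := by simp [hs]
    simpa only [packOuter, iInf_lt_iff, exists_prop] using this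
  refine h (measure_mono_null (t := ⋃ i, {x ∈ Zs i | ∃ᶠ n in atTop,
    μ (dynBall act (Fs n) x ε) ≤ ENNReal.ofReal (Real.exp (-r * ((Fs n).card : ℝ)))}) ?_ ?_)
  · rintro x ⟨hxZ, hx⟩
    obtain ⟨i, hi⟩ := mem_iUnion.1 (hZs hxZ)
    exact mem_iUnion.2 ⟨i, hi, hx⟩
  refine measure_iUnion_null fun i => ?_
  have hlim : packPLim act Fs (Zs i) (ε / 4) s < ∞ :=
    ((ENNReal.le_tsum i).trans_lt hsum).trans ENNReal.one_lt_top
  obtain ⟨N, hN⟩ := iInf_lt_iff.1 hlim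
  set E : ℕ → Set X := fun n => {x ∈ Zs i | N ≤ n ∧
    μ (dynBall act (Fs n) x ε) ≤ ENNReal.ofReal (Real.exp (-r * ((Fs n).card : ℝ)))}
  have hE : ∀ n, μ (E n) ≤ ENNReal.ofReal (Real.exp (-(r - s) * ((Fs n).card : ℝ))) *
      packP act Fs (Zs i) N (ε / 4) s := by
    intro n
    by_cases hn : N ≤ n
    · refine (measure_le_mul_packP hact Fs μ hn hε s fun x hx => hx.2.2).trans ?_
      gcongr
      exact packP_mono act Fs (fun x hx => hx.1) _ _ _
    · have : E n = ∅ := by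
        ext x
        simp [E, hn]
      simp [this]
  have hfin : ∑' n, μ (E n) ≠ ∞ := by
    refine ne_top_of_le_ne_top ?_ (ENNReal.tsum_le_tsum hE)
    rw [ENNReal.tsum_mul_right]
    refine ENNReal.mul_ne_top ?_ hN.ne
    exact (summable_exp_neg_card hgrow (sub_pos.2 hsr)).tsum_ofReal_ne_top
  refine measure_mono_null ?_ (measure_setOfPred_frequently_eq_zero (p := fun n x => x ∈ E n) hfin)
  rintro x ⟨hxZ, hx⟩
  exact (hx.and_eventually (eventually_ge_atTop N)).mono fun n hn => ⟨hxZ, hn.2, hn.1⟩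

theorem upperLocalEnt_le_packEnt [Group G] {act : G → X → X} (hact : ∀ g, Continuous (act g))
    {Fs : ℕ → Finset G} (hne : ∀ n, (Fs n).Nonempty) (hgrow : GrowthCond Fs) (μ : Measure X)
    [IsProbabilityMeasure μ] {Z : Set X} (hZ : MeasurableSet Z) :
    upperLocalEnt act Fs μ Z ≤ packEnt act Fs Z := by
  refine ENNReal.le_of_forall_nnreal_lt fun r hr => ?_
  set T : ℝ → Set X := fun ε => {x ∈ Z | ∃ᶠ n in atTop, μ (dynBall act (Fs n) x ε) ≤
      ENNReal.ofReal (Real.exp (-r * ((Fs n).card : ℝ)))}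
  obtain ⟨k, hk⟩ : ∃ k : ℕ, μ (T (1 / ((k : ℝ) + 1))) ≠ 0 := by
    by_contra! hT
    refine hr.not_ge ?_
    have hnull : μ (⋃ k : ℕ, T (1 / ((k : ℝ) + 1))) = 0 := measure_iUnion_null hT
    calc upperLocalEnt act Fs μ Z ≤ ∫⁻ _ in Z, (r : ℝ≥0∞) ∂μ := by
          refine lintegral_mono_ae ?_
          rw [ae_restrict_iff' hZ]
          filter_upwards [measure_eq_zero_iff_ae_notMem.1 hnull] with x hx hxZ
          by_contra! hlt
          simp only [lt_iSup_iff] at hlt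
          obtain ⟨ε, hε, hlt⟩ := hlt
          obtain ⟨k, hkε⟩ := exists_nat_one_div_lt hε
          refine hx (mem_iUnion.2 ⟨k, hxZ, ?_⟩)
          refine (frequently_lt_of_lt_limsup (by isBoundedDefault) hlt).mono fun n hn => ?_
          have hcard : (0 : ℝ) < (Fs n).card := by exact_mod_cast (hne n).card_pos
          rw [← ENNReal.ofReal_coe_nnreal] at hn
          have hn := (ENNReal.ofReal_lt_ofReal_iff_of_nonneg r.coe_nonneg).1 hn
          rw [lt_div_iff₀ hcard] at hn
          refine (measure_mono (dynBall_mono act _ x hkε.le)).trans ?_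
          rw [← ENNReal.ofReal_toReal (measure_ne_top μ (dynBall act (Fs n) x ε))]
          refine ENNReal.ofReal_le_ofReal ?_
          rcases (ENNReal.toReal_nonneg (a := μ (dynBall act (Fs n) x ε))).eq_or_lt with h0 | h0
          · rw [← h0]
            exact Real.exp_nonneg _
          · rw [← Real.log_le_iff_le_exp h0]
            linarith
      _ ≤ r := by
          rw [setLIntegral_const]
          exact mul_le_of_le_one_right bot_le prob_le_one
  have hpos : (0 : ℝ) < 1 / ((k : ℝ) + 1) := by positivity
  exact (le_packEntEps_of_frequently hact hgrow μ hpos hk).trans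
    (le_iSup₂_of_le (1 / ((k : ℝ) + 1) / 4) (by positivity) le_rfl)

theorem exists_measure_of_lt_packEnt [Group G] [BorelSpace X]
    {act : G → X → X} (hact : ∀ g, Continuous (act g))
    {Fs : ℕ → Finset G} (hne : ∀ n, (Fs n).Nonempty) (hgrow : GrowthCond Fs) {Z : Set X}
    (hZmeas : MeasurableSet Z) (hZ : AnalyticSet Z) {s : ℝ≥0} (hs : s < packEnt act Fs Z) :
    ∃ μ : Measure X, IsProbabilityMeasure μ ∧ μ Z = 1 ∧ s ≤ upperLocalEnt act Fs μ Z := by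
  simp only [packEnt, lt_iSup_iff] at hs
  obtain ⟨ε, hε, hs⟩ := hs
  obtain ⟨t, hst, ht⟩ := ENNReal.lt_iff_exists_nnreal_btwn.1 hs
  have hst : (s : ℝ) < t := by exact_mod_cast hst
  have hpos : packOuter act Fs Z ε t ≠ 0 := fun h0 => ht.not_ge (iInf₂_le t h0)
  obtain ⟨P, _, _, φ, hφ, rfl⟩ := analyticSet_iff_exists_polishSpace_range.1 hZ
  let _ := TopologicalSpace.upgradeIsCompletelyMetrizable P
  obtain ⟨Q, hQ, hQne, hQpos⟩ := exists_isClosed_locally_pos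
    (packOuterMeasure act Fs ε t) (φ := φ) hpos
  have : CompleteSpace Q := hQ.completeSpace_coe
  have : Nonempty Q := hQne.to_subtype
  have hφQ : Continuous fun q : Q => φ q := hφ.comp continuous_subtype_val
  obtain ⟨f, hf, hthin⟩ := exists_random_point hact hφQ s.coe_nonneg hε (Fs := Fs) (by
    rintro U hU ⟨q, hq⟩ N
    obtain ⟨V, hV, rfl⟩ := isOpen_induced_iff.1 hU
    by_contra htop
    refine hQpos V hV ⟨q, hq, q.2⟩ ?_
    have himage : (fun q : Q => φ q) '' (Subtype.val ⁻¹' V) = φ '' (V ∩ Q) := by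
      rw [inter_comm, ← Subtype.image_preimage_coe, image_image]
    rw [himage] at htop
    exact packOuter_eq_zero_of_packP_ne_top act hgrow hst htop)
  set Φ : ℝ → X := (fun q : Q => φ q) ∘ f
  set μ : Measure X := unitMeasure.map Φ
  have hμ : IsProbabilityMeasure μ := Measure.isProbabilityMeasure_map hf.aemeasurable
  have hμZ : μ (range φ) = 1 := by
    rw [Measure.map_apply hf hZmeas]
    have : Φ ⁻¹' range φ = univ := eq_univ_of_forall fun ω => mem_range_self _
    simp [this]
  refine ⟨μ, hμ, hμZ, ?_⟩
  have hmeas : MeasurableSet {x | ∀ N, ∃ n ≥ N, μ (dynBall act (Fs n) x (ε / 3)) ≤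
      ENNReal.ofReal (Real.exp (-s * ((Fs n).card : ℝ)))} := by
    simp only [ofPred_forall, ofPred_exists]
    refine MeasurableSet.iInter fun N => MeasurableSet.iUnion fun n => ?_
    simp only [ofPred_and]
    exact (MeasurableSet.const _).inter
      (measurableSet_le (measurable_measure_dynBall hact μ _ _) measurable_const)
  have hae : ∀ᵐ x ∂μ, ∀ N, ∃ n ≥ N, μ (dynBall act (Fs n) x (ε / 3)) ≤
      ENNReal.ofReal (Real.exp (-s * ((Fs n).card : ℝ))) := by
    rw [ae_map_iff hf.aemeasurable hmeas]
    refine ae_of_all _ fun ω N => ?_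
    obtain ⟨n, hn, h⟩ := hthin ω N
    refine ⟨n, hn, ?_⟩
    rw [Measure.map_apply hf (isOpen_dynBall hact _ _ _).measurableSet]
    exact h
  calc (s : ℝ≥0∞) = ∫⁻ _ in range φ, (s : ℝ≥0∞) ∂μ := by rw [setLIntegral_const, hμZ, mul_one]
    _ ≤ upperLocalEnt act Fs μ (range φ) := by
      refine lintegral_mono_ae (ae_restrict_of_ae ?_)
      filter_upwards [hae, μ.support_mem_ae] with x hx hxs
      have hε3 : 0 < ε / 3 := by positivity
      refine le_iSup₂_of_le (ε / 3) hε3 (le_limsup_of_frequently_le ?_ (by isBoundedDefault))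
      refine (frequently_atTop.2 hx).mono fun n hn => ?_
      have hball : 0 < μ (dynBall act (Fs n) x (ε / 3)) :=
        (Measure.mem_support_iff_forall x).1 hxs _
          ((isOpen_dynBall hact _ _ _).mem_nhds (mem_dynBall_self act _ _ hε3))
      have hball' := ENNReal.toReal_pos hball.ne' (measure_ne_top _ _)
      have hcard : (0 : ℝ) < (Fs n).card := by exact_mod_cast (hne n).card_pos
      rw [← ENNReal.ofReal_coe_nnreal]
      refine ENNReal.ofReal_le_ofReal ?_
      rw [le_div_iff₀ hcard]
      have h1 := ENNReal.toReal_le_of_le_ofReal (Real.exp_nonneg _) hn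
      have h2 := (Real.log_le_iff_le_exp hball').2 h1
      linarith

end VariationalPrinciple

theorem packing_entropy_variational_principle
    [Group G] [Countable G] [Infinite G] [DecidableEq G]
    [MetricSpace X] [CompactSpace X] [MeasurableSpace X] [BorelSpace X]
    (act : G → X → X)
    (hact_one : ∀ x, act 1 x = x)
    (hact_mul : ∀ g h x, act (g * h) x = act g (act h x))
    (hact_cont : ∀ g : G, Continuous (act g))
    (hamen : ∃ E : ℕ → Finset G, Folner E)
    (Fs : ℕ → Finset G) (hne : ∀ n, (Fs n).Nonempty) (hgrow : GrowthCond Fs)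
    (Z : Set X) (hZmeas : MeasurableSet Z) (hZne : Z.Nonempty) :
    packEnt act Fs Z =
      ⨆ (μ : Measure X) (_ : IsProbabilityMeasure μ) (_ : μ Z = 1),
        upperLocalEnt act Fs μ Z := by
  refine le_antisymm ?_ (iSup_le fun μ => iSup₂_le fun hμ _ =>
    upperLocalEnt_le_packEnt hact_cont hne hgrow μ hZmeas)
  refine ENNReal.le_of_forall_nnreal_lt fun s hs => ?_
  obtain ⟨μ, hμ, hμZ, h⟩ :=
    exists_measure_of_lt_packEnt hact_cont hne hgrow hZmeas hZmeas.analyticSet hs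
  exact le_iSup_of_le μ (le_iSup₂_of_le hμ hμZ h)

end AmenablePacking
end

section
/- Measure-theoretic entropy bounds packing entropy of full-measure sets: Let μ be a G-invariant Borel probability measure on X, Z ⊆ X with μ(Z) = 1, and {F_n} a Følner sequence in G. Then h_μ(X,G) ≤ h^P_top(Z,{F_n}), where h_μ(X,G) is the measure-theoretic entropy of (X,G) with respect to μ. -/
open Filter Set MeasureTheory ENNReal Topology
open scoped Pointwise symmDiff NNReal

namespace AmenablePacking

variable {G X Y : Type*}

/-- Gibbs' inequality. -/
theorem sum_negMulLog_le_sum_mul_neg_log {ι : Type*} [Fintype ι] {p q : ι → ℝ}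
    (hp : ∀ i, 0 ≤ p i) (hp1 : ∑ i, p i = 1) (hq : ∀ i, 0 < q i) (hq1 : ∑ i, q i ≤ 1) :
    ∑ i, Real.negMulLog (p i) ≤ ∑ i, p i * -Real.log (q i) := by
  have key : ∀ i, Real.negMulLog (p i) ≤ p i * -Real.log (q i) + (q i - p i) := by
    intro i
    rcases (hp i).eq_or_lt with h | h
    · simp [← h, (hq i).le]
    · have h1 := Real.log_le_sub_one_of_pos (div_pos (hq i) h)
      rw [Real.log_div (hq i).ne' h.ne'] at h1
      have h2 := mul_le_mul_of_nonneg_left h1 h.le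
      have h3 : p i * (q i / p i - 1) = q i - p i := by field_simp
      rw [h3] at h2
      unfold Real.negMulLog
      linarith
  have h := Finset.sum_le_sum fun i (_ : i ∈ Finset.univ) => key i
  rw [Finset.sum_add_distrib, Finset.sum_sub_distrib] at h
  linarith

theorem partEnt_le_integral [MeasurableSpace X] {μ : Measure X} [IsProbabilityMeasure μ]
    {ι : Type*} [Fintype ι] [MeasurableSpace ι] [MeasurableSingletonClass ι] {W : X → ι}
    (hW : Measurable W) {q : ι → ℝ} (hq : ∀ i, 0 < q i) (hq1 : ∑ i, q i ≤ 1)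
    {c : X → ℝ} (hc : Integrable c μ) (hqc : ∀ x, -Real.log (q (W x)) ≤ c x) :
    partEnt μ W ≤ ∫ x, c x ∂μ := by
  have hprob : IsProbabilityMeasure (μ.map W) := Measure.isProbabilityMeasure_map hW.aemeasurable
  have hmap : ∀ i, (μ (W ⁻¹' {i})).toReal = (μ.map W).real {i} := fun i => by
    rw [Measure.real, Measure.map_apply hW (measurableSet_singleton i)]
  have hint : Integrable (fun i => -Real.log (q i)) (μ.map W) := Integrable.of_finite
  have hint' : Integrable (fun x => -Real.log (q (W x))) μ := hint.comp_measurable hW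
  calc partEnt μ W ≤ ∑ i, (μ.map W).real {i} * -Real.log (q i) := by
        simp only [partEnt, hmap]
        refine sum_negMulLog_le_sum_mul_neg_log (fun _ => measureReal_nonneg) ?_ hq hq1
        simp
    _ = ∫ i, -Real.log (q i) ∂(μ.map W) := by
        rw [integral_fintype hint]
        simp
    _ = ∫ x, -Real.log (q (W x)) ∂μ :=
        integral_map hW.aemeasurable hint.aestronglyMeasurable
    _ ≤ ∫ x, c x ∂μ := integral_mono hint' hc hqc

/-- If every point of `K` is `F`-shadowed by a point of `E`, in the sense that its `P`-name can be
read off with `v` at the times when the orbit avoids `U`, then the entropy of the `P`-names is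
controlled by the cardinality of `E` and the measures of `U` and of the complement of `K`. -/
theorem partEnt_name_le [MeasurableSpace X] [DecidableEq G] {act : G → X → X} {μ : Measure X}
    [IsProbabilityMeasure μ] (hmeas : ∀ g, Measurable (act g)) (hinv : InvariantMeasure act μ)
    (F : Finset G) {k : ℕ} {P : X → Fin k} (hP : Measurable P) (v : X → Fin k)
    {U K : Set X} (hU : MeasurableSet U) (hK : MeasurableSet K) {E : Finset X} (hE : E.Nonempty)
    (hEK : ∀ x ∈ K, ∃ z ∈ E, ∀ g ∈ F, act g x ∉ U → v (act g z) = P (act g x))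
    {a b : ℝ} (ha : 0 < a) (hb : 0 < b) (hb1 : b ≤ 1) (hab : a + k * b ≤ 1) :
    partEnt μ (fun x (g : F) => P (act (g : G) x)) ≤
      Real.log E.card + F.card * -Real.log a
        + F.card * -Real.log b * (μ.real U + μ.real Kᶜ) := by
  have ha1 : a ≤ 1 := by nlinarith [show (0 : ℝ) ≤ k from Nat.cast_nonneg k]
  have hlb : 0 ≤ -Real.log b := by linarith [Real.log_nonpos hb.le hb1]
  have hla : 0 ≤ -Real.log a := by linarith [Real.log_nonpos ha.le ha1]
  have hEc : (0 : ℝ) < E.card := by exact_mod_cast hE.card_pos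
  set r : X → F → Fin k → ℝ := fun z g i => if v (act g z) = i then a else b with hr
  have hrpos : ∀ z g i, 0 < r z g i := fun z g i => by
    simp only [hr]; split_ifs <;> assumption
  have hrsum : ∀ z g, ∑ i, r z g i ≤ 1 := fun z g => by
    calc ∑ i, r z g i ≤ ∑ i, ((if v (act g z) = i then a else 0) + b) :=
          Finset.sum_le_sum fun i _ => by simp only [hr]; split_ifs <;> linarith
      _ = a + k * b := by simp [Finset.sum_add_distrib]
      _ ≤ 1 := hab
  set q : (F → Fin k) → ℝ := fun w => (E.card : ℝ)⁻¹ * ∑ z ∈ E, ∏ g, r z g (w g) with hq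
  have hqz : ∀ w, ∀ z ∈ E, (E.card : ℝ)⁻¹ * ∏ g, r z g (w g) ≤ q w := fun w z hz => by
    refine mul_le_mul_of_nonneg_left ?_ (by positivity)
    exact Finset.single_le_sum (f := fun z => ∏ g, r z g (w g))
      (fun z _ => Finset.prod_nonneg fun g _ => (hrpos _ _ _).le) hz
  have hqpos : ∀ w, 0 < q w := fun w =>
    mul_pos (by positivity) (Finset.sum_pos (fun z _ => Finset.prod_pos fun g _ => hrpos _ _ _) hE)
  have hqsum : ∑ w, q w ≤ 1 := by
    simp only [hq]
    rw [← Finset.mul_sum, Finset.sum_comm, inv_mul_le_iff₀ hEc, mul_one]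
    calc ∑ z ∈ E, ∑ w : F → Fin k, ∏ g, r z g (w g) ≤ ∑ z ∈ E, (1 : ℝ) := by
          refine Finset.sum_le_sum fun z _ => ?_
          rw [← Fintype.piFinset_univ, ← Finset.prod_univ_sum]
          exact Finset.prod_le_one
            (fun g _ => Finset.sum_nonneg fun i _ => (hrpos _ _ _).le) fun g _ => hrsum z g
      _ = E.card := by simp
  set c : X → ℝ := fun x => Real.log E.card + ∑ g : F,
    (-Real.log a + -Real.log b *
      ((act g ⁻¹' U).indicator 1 x + Kᶜ.indicator 1 x)) with hc
  have hind : ∀ s : Set X, MeasurableSet s → Integrable (s.indicator (1 : X → ℝ)) μ :=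
    fun s hs => (integrable_const (1 : ℝ)).indicator hs
  have hterm : ∀ g : F, Integrable (fun x => -Real.log b *
      ((act g ⁻¹' U).indicator (1 : X → ℝ) x + Kᶜ.indicator (1 : X → ℝ) x)) μ := fun g =>
    ((hind _ (hmeas g hU)).add (hind _ hK.compl)).const_mul _
  have hcint : Integrable c μ :=
    (integrable_const _).add (integrable_finsetSum _ fun g _ => (integrable_const _).add (hterm g))
  have hcval : ∫ x, c x ∂μ = Real.log E.card + F.card * -Real.log a
        + F.card * -Real.log b * (μ.real U + μ.real Kᶜ) := by
    have h1 : ∀ g : F, ∫ x, (-Real.log a + -Real.log b *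
        ((act g ⁻¹' U).indicator (1 : X → ℝ) x + Kᶜ.indicator (1 : X → ℝ) x)) ∂μ =
        -Real.log a + -Real.log b * (μ.real U + μ.real Kᶜ) := fun g => by
      rw [integral_add (integrable_const _) (hterm g), integral_const_mul,
        integral_add (hind _ (hmeas g hU)) (hind _ hK.compl),
        integral_indicator_one (hmeas g hU), integral_indicator_one hK.compl]
      simp [Measure.real, hinv g U hU]
    simp only [hc]
    have h2 : ∀ g : F, Integrable (fun x => -Real.log a + -Real.log b *
        ((act g ⁻¹' U).indicator (1 : X → ℝ) x + Kᶜ.indicator (1 : X → ℝ) x)) μ := fun g =>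
      (integrable_const _).add (hterm g)
    rw [integral_add (integrable_const _) (integrable_finsetSum _ fun g _ => h2 g),
      integral_finsetSum _ fun g _ => h2 g]
    simp only [h1]
    simp
    ring
  have hW : Measurable fun x (g : F) => P (act (g : G) x) :=
    measurable_pi_lambda _ fun g => hP.comp (hmeas g)
  rw [← hcval]
  refine partEnt_le_integral hW hqpos hqsum hcint fun x => ?_
  obtain ⟨z, hz, hzx⟩ : ∃ z ∈ E, x ∈ K → ∀ g ∈ F, act g x ∉ U → v (act g z) = P (act g x) := by
    by_cases hx : x ∈ K
    · obtain ⟨z, hz, h⟩ := hEK x hx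
      exact ⟨z, hz, fun _ => h⟩
    · exact ⟨_, hE.choose_spec, fun h => absurd h hx⟩
  have h1 : Real.log ((E.card : ℝ)⁻¹ * ∏ g : F, r z g (P (act g x))) ≤
      Real.log (q fun g => P (act g x)) :=
    Real.log_le_log (mul_pos (by positivity) (Finset.prod_pos fun g _ => hrpos _ _ _))
      (hqz _ z hz)
  rw [Real.log_mul (by positivity) (Finset.prod_pos fun g _ => hrpos _ _ _).ne', Real.log_inv,
    Real.log_prod fun g _ => (hrpos _ _ _).ne'] at h1
  have h2 : ∀ g : F, -Real.log (r z g (P (act g x))) ≤ -Real.log a + -Real.log b *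
      ((act g ⁻¹' U).indicator 1 x + Kᶜ.indicator 1 x) := by
    intro g
    have hn1 : (0 : ℝ) ≤ (act g ⁻¹' U).indicator 1 x := indicator_nonneg (by simp) x
    have hn2 : (0 : ℝ) ≤ Kᶜ.indicator 1 x := indicator_nonneg (by simp) x
    by_cases hv : v (act g z) = P (act g x)
    · simp only [hr, hv, if_true]
      nlinarith
    · have hge : (1 : ℝ) ≤ (act g ⁻¹' U).indicator 1 x + Kᶜ.indicator 1 x := by
        by_cases hxU : act g x ∈ U
        · have : (act g ⁻¹' U).indicator (1 : X → ℝ) x = 1 := by simp [hxU]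
          linarith
        · have hxK : x ∉ K := fun hxK => hv (hzx hxK g g.2 hxU)
          have : Kᶜ.indicator (1 : X → ℝ) x = 1 := by simp [hxK]
          linarith
      simp only [hr, hv, if_false]
      nlinarith
  have h3 := Finset.sum_le_sum fun g (_ : g ∈ Finset.univ) => h2 g
  rw [Finset.sum_neg_distrib] at h3
  simp only [hc]
  linarith

theorem card_mul_exp_le_packP [PseudoMetricSpace X] {act : G → X → X} {Fs : ℕ → Finset G}
    {Z : Set X} {N n : ℕ} (hn : N ≤ n) {ε s : ℝ} {E : Finset X} (hEZ : ↑E ⊆ Z)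
    (hE : (E : Set X).PairwiseDisjoint fun x => dynClosedBall act (Fs n) x ε) :
    (E.card : ℝ≥0∞) * ENNReal.ofReal (Real.exp (-s * ((Fs n).card : ℝ))) ≤
      packP act Fs Z N ε s := by
  rcases E.eq_empty_or_nonempty with rfl | ⟨x₀, -⟩
  · simp
  set e := E.equivFin
  set c : ℕ → X × ℕ := fun i => if h : i < E.card then ((e.symm ⟨i, h⟩ : X), n) else (x₀, n) with hc
  have hc2 : ∀ i, (c i).2 = n := fun i => by simp only [hc]; split_ifs <;> rfl
  have hc1 : ∀ i (h : i < E.card), (c i).1 = e.symm ⟨i, h⟩ := fun i h => by simp [hc, h]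
  refine le_trans (le_of_eq ?_) <| le_iSup₂_of_le (Set.Iio E.card) c <| le_iSup₂_of_le
    (fun i hi => ⟨?_, ?_⟩) (fun i hi j hj hij => ?_) le_rfl
  · simp only [hc2]
    rw [ENNReal.tsum_const]
    simp
  · rw [hc1 i hi]
    exact hEZ (e.symm ⟨i, hi⟩).2
  · rw [hc2]; exact hn
  · rw [hc2, hc2, hc1 i hi, hc1 j hj]
    refine hE (e.symm ⟨i, hi⟩).2 (e.symm ⟨j, hj⟩).2 fun h => hij ?_
    exact congrArg Fin.val (e.symm.injective (Subtype.ext h))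

theorem isClosed_dynClosedBall [PseudoMetricSpace X] {act : G → X → X}
    (hact : ∀ g, Continuous (act g)) (F : Finset G) (x : X) (ε : ℝ) :
    IsClosed (dynClosedBall act F x ε) := by
  have h : dynClosedBall act F x ε = ⋂ g ∈ F, {y | dist (act g x) (act g y) ≤ ε} := by
    ext y; simp [dynClosedBall]
  rw [h]
  exact isClosed_biInter fun g _ => isClosed_le (continuous_const.dist (hact g)) continuous_const

/-- Sets of small packing pre-measure have few-element dynamical nets. -/
theorem exists_finset_closure_subset [PseudoMetricSpace X] {act : G → X → X}
    (hact : ∀ g, Continuous (act g)) {Fs : ℕ → Finset G}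
    {Z : Set X} {N n : ℕ} (hn : N ≤ n) {ε s : ℝ} (hε : 0 ≤ ε) (hpack : packP act Fs Z N ε s ≤ 1) :
    ∃ E : Finset X, (E.card : ℝ) ≤ Real.exp (s * (Fs n).card) ∧
      closure Z ⊆ ⋃ x ∈ E, dynClosedBall act (Fs n) x (2 * ε) := by
  classical
  have hself : ∀ x : X, x ∈ dynClosedBall act (Fs n) x ε := fun x g _ => by simpa using hε
  let A : Set ℕ := {m | ∃ E : Finset X, (↑E ⊆ Z ∧
    (E : Set X).PairwiseDisjoint fun x => dynClosedBall act (Fs n) x ε) ∧ E.card = m}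
  have hcard : ∀ E : Finset X, ↑E ⊆ Z →
      ((E : Set X).PairwiseDisjoint fun x => dynClosedBall act (Fs n) x ε) →
      (E.card : ℝ) ≤ Real.exp (s * (Fs n).card) := by
    intro E hEZ hE
    have h := (card_mul_exp_le_packP (s := s) hn hEZ hE).trans hpack
    rw [← ENNReal.ofReal_natCast, ← ENNReal.ofReal_mul (by positivity), ENNReal.ofReal_le_one] at h
    rw [neg_mul, Real.exp_neg, ← div_eq_mul_inv, div_le_one (Real.exp_pos _)] at h
    exact h
  have hbdd : BddAbove A := by
    refine ⟨⌊Real.exp (s * (Fs n).card)⌋₊, ?_⟩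
    rintro _ ⟨E, ⟨h1, h2⟩, rfl⟩
    exact Nat.le_floor (hcard E h1 h2)
  obtain ⟨E, ⟨hEZ, hE⟩, hEm⟩ : sSup A ∈ A := Nat.sSup_mem ⟨0, ∅, by simp, rfl⟩ hbdd
  refine ⟨E, hcard E hEZ hE, closure_minimal (fun y hy => ?_)
    (isClosed_biUnion_finset fun x _ => isClosed_dynClosedBall hact _ _ _)⟩
  obtain ⟨x, hx, hxy⟩ : ∃ x ∈ E, ¬ Disjoint (dynClosedBall act (Fs n) y ε)
      (dynClosedBall act (Fs n) x ε) := by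
    by_contra! hcon
    have hyE : y ∉ E := fun h => Set.disjoint_left.1 (hcon y h) (hself y) (hself y)
    have hmem : (insert y E).card ∈ A := by
      refine ⟨insert y E, ⟨?_, ?_⟩, rfl⟩
      · rw [Finset.coe_insert]
        exact Set.insert_subset hy hEZ
      · rw [Finset.coe_insert]
        exact hE.insert fun x hx _ => hcon x hx
    have := le_csSup hbdd hmem
    rw [Finset.card_insert_of_notMem hyE] at this
    omega
  obtain ⟨w, hwy, hwx⟩ := Set.not_disjoint_iff.1 hxy
  refine Set.mem_iUnion₂.2 ⟨x, hx, fun g hg => ?_⟩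
  have h1 := hwy g hg
  have h2 := hwx g hg
  have h3 := dist_triangle_right (act g x) (act g y) (act g w)
  linarith

theorem Folner.tendsto_card [Group G] [Infinite G] [DecidableEq G] {Fs : ℕ → Finset G}
    (hF : Folner Fs) : Tendsto (fun n => ((Fs n).card : ℝ)) atTop atTop := by
  refine tendsto_natCast_atTop_atTop.comp (tendsto_atTop.2 fun C => ?_)
  obtain ⟨T, hT⟩ := Infinite.exists_subset_card_eq G C
  have hC : (0 : ℝ) < 1 / (C + 1) := by positivity
  have hev : ∀ᶠ n in atTop, ∀ g ∈ T,
      ((((Fs n).image fun h => g * h) ∆ Fs n).card : ℝ) / ((Fs n).card : ℝ) < 1 / (C + 1) :=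
    (Finset.eventually_all T).2 fun g _ => (hF.2 g).eventually (gt_mem_nhds hC)
  filter_upwards [hev] with n hn
  by_contra! hlt
  obtain ⟨f, hf⟩ := hF.1 n
  have hpos : (0 : ℝ) < (Fs n).card := by exact_mod_cast (hF.1 n).card_pos
  have hsub : (T.image fun g => g * f) ⊆ Fs n := by
    intro y hy
    obtain ⟨g, hg, rfl⟩ := Finset.mem_image.1 hy
    have h := hn g hg
    rw [div_lt_div_iff₀ hpos (by positivity)] at h
    have hlt' : ((Fs n).card : ℝ) < C := by exact_mod_cast hlt
    by_contra hnot
    have : 1 ≤ (((Fs n).image fun h => g * h) ∆ Fs n).card := Finset.card_pos.2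
      ⟨g * f, Finset.mem_symmDiff.2 (Or.inl ⟨Finset.mem_image_of_mem _ hf, hnot⟩)⟩
    have : (1 : ℝ) ≤ (((Fs n).image fun h => g * h) ∆ Fs n).card := by exact_mod_cast this
    nlinarith [show (0 : ℝ) ≤ C from Nat.cast_nonneg C]
  have := Finset.card_le_card hsub
  rw [Finset.card_image_of_injective _ (mul_left_injective f), hT] at this
  omega

/-- A finite measurable partition of a compact metric space can be recovered from approximate
positions of points, off an open set of small measure. -/
theorem exists_open_approx_partition [MetricSpace X] [CompactSpace X] [MeasurableSpace X]
    [BorelSpace X] (μ : Measure X) [IsFiniteMeasure μ] {k : ℕ} {P : X → Fin k} (hP : Measurable P)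
    {η : ℝ} (hη : 0 < η) :
    ∃ U : Set X, IsOpen U ∧ μ.real U ≤ η ∧ ∃ r > 0, ∃ v : X → Fin k,
      ∀ z y, dist z y ≤ r → y ∉ U → v z = P y := by
  classical
  have hη' : ENNReal.ofReal (η / (k + 1)) ≠ 0 := by
    simp only [ne_eq, ENNReal.ofReal_eq_zero, not_le]; positivity
  choose A hAP hAc hAμ using fun i : Fin k =>
    (hP (measurableSet_singleton i)).exists_isClosed_sdiff_lt (μ := μ) (measure_ne_top _ _) hη'
  refine ⟨(⋃ i, A i)ᶜ, (isClosed_iUnion_of_finite hAc).isOpen_compl, ?_, ?_⟩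
  · have hsub : (⋃ i, A i)ᶜ ⊆ ⋃ i, (P ⁻¹' {i} \ A i) := fun x hx =>
      Set.mem_iUnion.2 ⟨P x, rfl, fun h => hx (Set.mem_iUnion.2 ⟨_, h⟩)⟩
    calc μ.real (⋃ i, A i)ᶜ ≤ μ.real (⋃ i, (P ⁻¹' {i} \ A i)) := measureReal_mono hsub
      _ ≤ ∑ i, μ.real (P ⁻¹' {i} \ A i) := measureReal_iUnion_fintype_le _
      _ ≤ ∑ _i : Fin k, η / (k + 1) := Finset.sum_le_sum fun i _ =>
          ENNReal.toReal_le_of_le_ofReal (by positivity) (hAμ i).le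
      _ = k * (η / (k + 1)) := by simp
      _ ≤ η := by
          rw [← mul_div_assoc, div_le_iff₀ (by positivity)]
          nlinarith
  · have hdisj : ∀ p : Fin k × Fin k, ∃ δ : ℝ, 0 < δ ∧
        (p.1 ≠ p.2 → ∀ x ∈ A p.1, ∀ y ∈ A p.2, δ ≤ dist x y) := by
      rintro ⟨i, j⟩
      by_cases hij : i = j
      · exact ⟨1, one_pos, fun h => absurd hij h⟩
      · have hd : Disjoint (A i) (A j) := Set.disjoint_left.2 fun x hx hx' =>
          hij ((hAP i hx).symm.trans (hAP j hx'))
        obtain ⟨δ, hδ, h⟩ := Metric.exists_pos_forall_lt_edist (hAc i).isCompact (hAc j) hd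
        refine ⟨δ, hδ, fun _ x hx y hy => ?_⟩
        have := h x hx y hy
        rw [edist_nndist] at this
        exact_mod_cast this.le
    choose δ hδ hδA using hdisj
    obtain ⟨r, hr, hrδ⟩ : ∃ r > 0, ∀ p, r < δ p := by
      have : ∀ᶠ r in 𝓝[>] (0 : ℝ), ∀ p, r < δ p := eventually_all.2 fun p =>
        (eventually_lt_nhds (hδ p)).filter_mono nhdsWithin_le_nhds
      obtain ⟨r, hr, h⟩ := (this.and self_mem_nhdsWithin).exists
      exact ⟨r, h, hr⟩
    have hv : ∀ z, ∃ i : Fin k, ∀ y, dist z y ≤ r / 2 → y ∉ (⋃ i, A i)ᶜ → i = P y := by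
      intro z
      have hA : ∀ y, y ∉ (⋃ i, A i)ᶜ → y ∈ A (P y) := fun y hy => by
        obtain ⟨i, hi⟩ := Set.mem_iUnion.1 (not_not.1 hy)
        have : P y = i := hAP i hi
        rwa [this]
      by_cases h : ∃ y, dist z y ≤ r / 2 ∧ y ∉ (⋃ i, A i)ᶜ
      · obtain ⟨y, hy, hyU⟩ := h
        refine ⟨P y, fun y' hy' hyU' => ?_⟩
        by_contra hne
        have h1 := hδA (P y, P y') hne y (hA y hyU) y' (hA y' hyU')
        have h2 := dist_triangle_left y y' z
        linarith [hrδ (P y, P y')]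
      · push Not at h
        exact ⟨P z, fun y hy hyU => absurd (h y hy) hyU⟩
    choose v hv using hv
    exact ⟨r / 2, by positivity, v, hv⟩

/-- If the packing outer measure of a set of full measure vanishes, then most of the space has
dynamical nets growing at the corresponding exponential rate. -/
theorem exists_nets_of_packOuter_eq_zero [MetricSpace X] [MeasurableSpace X] [BorelSpace X]
    {act : G → X → X} (hact : ∀ g, Continuous (act g)) {Fs : ℕ → Finset G} {μ : Measure X}
    [IsProbabilityMeasure μ] {Z : Set X} (hZ : μ Z = 1) {ε s : ℝ} (hε : 0 ≤ ε)
    (hpack : packOuter act Fs Z ε s = 0) {δ : ℝ} (hδ : 0 < δ) (hδ1 : δ < 1) :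
    ∃ K : Set X, MeasurableSet K ∧ μ.real Kᶜ ≤ δ ∧ ∃ m N : ℕ, ∀ n ≥ N, ∃ E : Finset X,
      E.Nonempty ∧ (E.card : ℝ) ≤ m * Real.exp (s * (Fs n).card) ∧
        K ⊆ ⋃ x ∈ E, dynClosedBall act (Fs n) x (2 * ε) := by
  classical
  have h1 : packOuter act Fs Z ε s < 1 := by rw [hpack]; exact one_pos
  simp only [packOuter, iInf_lt_iff] at h1
  obtain ⟨Zs, hZs, hsum⟩ := h1
  have hN : ∀ i, ∃ N, packP act Fs (Zs i) N ε s < 1 := fun i =>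
    iInf_lt_iff.1 ((ENNReal.le_tsum i).trans_lt hsum)
  choose N hN using hN
  set K : ℕ → Set X := fun m => ⋃ i ∈ Finset.range m, closure (Zs i) with hK
  have hKc : ∀ m, IsClosed (K m) := fun m => isClosed_biUnion_finset fun i _ => isClosed_closure
  have hKmono : Monotone K := fun m m' h =>
    Set.biUnion_subset_biUnion_left fun i hi => Finset.range_mono h hi
  have hKZ : Z ⊆ ⋃ m, K m := fun x hx => by
    obtain ⟨i, hi⟩ := Set.mem_iUnion.1 (hZs hx)
    exact Set.mem_iUnion.2 ⟨i + 1, Set.mem_iUnion₂.2 ⟨i, by simp, subset_closure hi⟩⟩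
  have hone : μ (⋃ m, K m) = 1 := le_antisymm prob_le_one (hZ ▸ measure_mono hKZ)
  have htend : Tendsto (fun m => μ (K m)) atTop (𝓝 1) := hone ▸ tendsto_measure_iUnion_atTop hKmono
  have htend' : Tendsto (fun m => μ.real (K m)) atTop (𝓝 1) :=
    (ENNReal.tendsto_toReal one_ne_top).comp htend
  obtain ⟨m, hm⟩ := (htend'.eventually (lt_mem_nhds (show 1 - δ < 1 by linarith))).exists
  refine ⟨K m, (hKc m).measurableSet, ?_, m, (Finset.range m).sup N, fun n hn => ?_⟩
  · rw [probReal_compl_eq_one_sub (hKc m).measurableSet]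
    linarith
  choose E hEcard hEcov using fun i : ℕ => fun hi : i ∈ Finset.range m =>
    exists_finset_closure_subset hact ((Finset.le_sup hi).trans hn) hε (hN i).le
  set E' : Finset X := (Finset.range m).attach.biUnion fun i => E i i.2 with hE'
  have hcov : K m ⊆ ⋃ x ∈ E', dynClosedBall act (Fs n) x (2 * ε) := by
    intro y hy
    obtain ⟨i, hi, hyi⟩ := Set.mem_iUnion₂.1 hy
    obtain ⟨x, hx, hyx⟩ := Set.mem_iUnion₂.1 (hEcov i hi hyi)
    exact Set.mem_iUnion₂.2 ⟨x, Finset.mem_biUnion.2 ⟨⟨i, hi⟩, Finset.mem_attach _ _, hx⟩, hyx⟩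
  refine ⟨E', ?_, ?_, hcov⟩
  · by_contra hne
    rw [Finset.not_nonempty_iff_eq_empty] at hne
    rw [hne] at hcov
    have h0 : K m = ∅ := by simpa using hcov
    rw [h0, measureReal_empty] at hm
    linarith
  · calc (E'.card : ℝ) ≤ ∑ i ∈ (Finset.range m).attach, ((E i i.2).card : ℝ) := by
          exact_mod_cast Finset.card_biUnion_le
      _ ≤ ∑ i ∈ (Finset.range m).attach, Real.exp (s * (Fs n).card) :=
          Finset.sum_le_sum fun i _ => hEcard i i.2
      _ = m * Real.exp (s * (Fs n).card) := by simp

theorem eventually_partEnt_div_card_le [Group G] [Infinite G] [DecidableEq G]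
    [MetricSpace X] [CompactSpace X] [MeasurableSpace X] [BorelSpace X]
    {act : G → X → X} (hact : ∀ g, Continuous (act g)) {Fs : ℕ → Finset G} (hFol : Folner Fs)
    {μ : Measure X} [IsProbabilityMeasure μ] (hinv : InvariantMeasure act μ)
    {Z : Set X} (hZ : μ Z = 1) {k : ℕ} {P : X → Fin k} (hP : Measurable P) {s : ℝ}
    (hs : ∀ ε > 0, ∃ s' ≤ s, packOuter act Fs Z ε s' = 0) {κ : ℝ} (hκ : 0 < κ) :
    ∀ᶠ n in atTop,
      partEnt μ (fun x (g : (Fs n : Finset G)) => P (act (g : G) x)) / ((Fs n).card : ℝ)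
        ≤ s + κ := by
  set a := Real.exp (-(κ / 4)) with ha
  have ha1 : a < 1 := Real.exp_zero ▸ Real.exp_lt_exp.2 (by linarith)
  have ha0 : 0 < a := Real.exp_pos _
  set b := (1 - a) / (k + 1) with hb
  have hk : (0 : ℝ) ≤ k := Nat.cast_nonneg k
  have hb0 : 0 < b := div_pos (by linarith) (by positivity)
  have hbk : b * (k + 1) = 1 - a := by rw [hb]; field_simp
  have hb1 : b ≤ 1 := by nlinarith
  set B := -Real.log b with hB
  have hB0 : 0 ≤ B := by linarith [Real.log_nonpos hb0.le hb1]
  set η := min (κ / (4 * (B + 1))) (1 / 2) with hη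
  have hη0 : 0 < η := by positivity
  have hηB : B * η ≤ κ / 4 := by
    calc B * η ≤ B * (κ / (4 * (B + 1))) := mul_le_mul_of_nonneg_left (min_le_left _ _) hB0
      _ = κ / 4 * (B / (B + 1)) := by field_simp
      _ ≤ κ / 4 * 1 := by
          refine mul_le_mul_of_nonneg_left ?_ (by positivity)
          rw [div_le_one (by positivity)]; linarith
      _ = κ / 4 := mul_one _
  obtain ⟨U, hU, hUη, r, hr, v, hv⟩ := exists_open_approx_partition μ hP hη0
  obtain ⟨s', hs', hpack⟩ := hs (r / 2) (by positivity)
  obtain ⟨K, hK, hKη, m, N, hnets⟩ := exists_nets_of_packOuter_eq_zero hact hZ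
    (by positivity) hpack hη0 ((min_le_right _ _).trans_lt (by norm_num))
  have hlarge := hFol.tendsto_card.eventually_ge_atTop (Real.log m / (κ / 4))
  filter_upwards [hlarge, eventually_ge_atTop N] with n hn hnN
  obtain ⟨E, hE, hEcard, hEcov⟩ := hnets n hnN
  have hFpos : (0 : ℝ) < (Fs n).card := by exact_mod_cast (hFol.1 n).card_pos
  have hent := partEnt_name_le (fun g => (hact g).measurable) hinv (Fs n) hP v
    hU.measurableSet hK hE (fun x hx => by
      obtain ⟨z, hz, hzx⟩ := Set.mem_iUnion₂.1 (hEcov hx)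
      exact ⟨z, hz, fun g hg hgU => hv _ _ (by linarith [hzx g hg]) hgU⟩) ha0 hb0 hb1
    (by linarith)
  have hEpos : (0 : ℝ) < E.card := by exact_mod_cast hE.card_pos
  have hm : (0 : ℝ) < m := pos_of_mul_pos_left (hEpos.trans_le hEcard) (Real.exp_pos _).le
  have hlog : Real.log E.card ≤ Real.log m + s' * (Fs n).card := by
    have := Real.log_le_log hEpos hEcard
    rwa [Real.log_mul hm.ne' (Real.exp_pos _).ne', Real.log_exp] at this
  have hla : -Real.log a = κ / 4 := by rw [ha, Real.log_exp]; ring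
  rw [div_le_iff₀ (by positivity)] at hn
  rw [div_le_iff₀ hFpos]
  have h1 : B * (μ.real U + μ.real Kᶜ) ≤ κ / 2 := by
    nlinarith [mul_le_mul_of_nonneg_left (add_le_add hUη hKη) hB0]
  rw [hla, mul_assoc] at hent
  nlinarith [mul_le_mul_of_nonneg_left h1 hFpos.le, mul_le_mul_of_nonneg_right hs' hFpos.le]

theorem measure_entropy_le_packing_entropy_of_full_measure
    [Group G] [Countable G] [Infinite G] [DecidableEq G]
    [MetricSpace X] [CompactSpace X] [MeasurableSpace X] [BorelSpace X]
    (act : G → X → X)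
    (hact_one : ∀ x, act 1 x = x)
    (hact_mul : ∀ g h x, act (g * h) x = act g (act h x))
    (hact_cont : ∀ g : G, Continuous (act g))
    (Fs : ℕ → Finset G) (hFol : Folner Fs)
    (μ : Measure X) [IsProbabilityMeasure μ] (hinv : InvariantMeasure act μ)
    (Z : Set X) (hZ : μ Z = 1) :
    measEnt act Fs μ ≤ packEnt act Fs Z := by
  refine iSup_le fun k => iSup₂_le fun P hP => le_of_forall_gt fun t ht => ?_
  obtain ⟨s, hs, hst⟩ := ENNReal.lt_iff_exists_nnreal_btwn.1 ht
  obtain ⟨s₁, hs₁, hst₁⟩ := ENNReal.lt_iff_exists_nnreal_btwn.1 hst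
  have hpack : ∀ ε > 0, ∃ s' ≤ (s : ℝ), packOuter act Fs Z ε s' = 0 := by
    intro ε hε
    have h : packEntEps act Fs Z ε < s :=
      (le_iSup₂ (f := fun (ε : ℝ) (_ : 0 < ε) => packEntEps act Fs Z ε) ε hε).trans_lt hs
    simp only [packEntEps, iInf_lt_iff] at h
    obtain ⟨s', h0, hlt⟩ := h
    exact ⟨s', by exact_mod_cast hlt.le, h0⟩
  have hκ : (0 : ℝ) < s₁ - s := sub_pos.2 (by exact_mod_cast hs₁)
  refine (limsup_le_of_le (by isBoundedDefault) ?_).trans_lt hst₁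
  filter_upwards [eventually_partEnt_div_card_le hact_cont hFol hinv hZ hP hpack hκ] with n hn
  refine (ENNReal.ofReal_le_ofReal hn).trans ?_
  rw [add_sub_cancel, ENNReal.ofReal_coe_nnreal]

end AmenablePacking
end

section
/- Packing entropy is bounded above by upper capacity entropy: Let {F_n} be a sequence of finite subsets of G satisfying the growth condition. Then for any subset Z of X and any ε > 0, h^P_top(Z,ε,{F_n}) ≤ h^{UC}_top(Z,ε,{F_n}), and hence h^P_top(Z,{F_n}) ≤ h^{UC}_top(Z,{F_n}). -/
open Filter Set MeasureTheory ENNReal Topology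
open scoped Pointwise symmDiff NNReal

namespace AmenablePacking

variable {G X Y : Type*}

lemma bddAbove_card_dynSeparated [PseudoMetricSpace X] [CompactSpace X] (act : G → X → X)
    (hact_cont : ∀ g : G, Continuous (act g)) (F : Finset G) (Z : Set X) {ε : ℝ} (hε : 0 < ε) :
    BddAbove {k : ℕ | ∃ E : Finset X, ↑E ⊆ Z ∧ IsDynSeparated act F ε ↑E ∧ E.card = k} := by
  obtain ⟨t, ht⟩ := CompactSpace.elim_nhds_subcover (fun x => dynBall act F x (ε / 2)) fun x => by
    have hopen : ∀ᶠ y in 𝓝 x, ∀ g ∈ F, dist (act g x) (act g y) < ε / 2 :=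
      (Filter.eventually_all_finset F).2 fun g _ =>
        (continuous_const.dist (hact_cont g)).continuousAt.eventually_lt_const (by simpa)
    exact hopen
  refine ⟨t.card, ?_⟩
  rintro _ ⟨E, -, hE, rfl⟩
  have hcover : ∀ y : X, ∃ x ∈ t, y ∈ dynBall act F x (ε / 2) := fun y => by
    simpa using ht.ge (mem_univ y)
  choose p hpt hp using hcover
  refine Finset.card_le_card_of_injOn p (fun y _ => hpt y) fun y hy z hz hyz => ?_
  by_contra hne
  obtain ⟨g, hg, hlt⟩ := hE y hy z hz hne
  have hy' := hp y g hg
  have hz' := hp z g hg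
  rw [hyz] at hy'
  linarith [dist_triangle_left (act g y) (act g z) (act g (p z))]

lemma card_le_sepNum [PseudoMetricSpace X] [CompactSpace X] {act : G → X → X}
    (hact_cont : ∀ g : G, Continuous (act g)) {F : Finset G} {Z : Set X} {ε : ℝ} (hε : 0 < ε)
    {ι : Type*} (J : Finset ι) (x : ι → X) (hxZ : ∀ i ∈ J, x i ∈ Z)
    (hdisj : ∀ i ∈ J, ∀ j ∈ J, i ≠ j →
      Disjoint (dynClosedBall act F (x i) ε) (dynClosedBall act F (x j) ε)) :
    J.card ≤ sepNum act F Z ε := by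
  classical
  have hmem : ∀ y, y ∈ dynClosedBall act F y ε := fun y g _ => by simpa using hε.le
  have hinj : Set.InjOn x J := fun i hi j hj hij => by
    by_contra hne
    exact Set.disjoint_left.1 (hdisj i hi j hj hne) (hmem _) (hij ▸ hmem _)
  refine le_csSup (bddAbove_card_dynSeparated act hact_cont F Z hε)
    ⟨J.image x, ?_, ?_, Finset.card_image_of_injOn hinj⟩
  · simpa [Set.subset_def] using hxZ
  · intro y hy z hz hyz
    obtain ⟨i, hi, rfl⟩ := Finset.mem_image.1 hy
    obtain ⟨j, hj, rfl⟩ := Finset.mem_image.1 hz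
    by_contra! hle
    exact Set.disjoint_left.1 (hdisj i hi j hj fun h => hyz (h ▸ rfl)) hle (hmem _)

lemma GrowthCond.summable_exp [Group G] {Fs : ℕ → Finset G} (hgrow : GrowthCond Fs) {c : ℝ}
    (hc : 0 < c) : Summable fun n => Real.exp (-c * ((Fs n).card : ℝ)) := by
  refine Summable.of_norm_bounded_eventually_nat
    (Real.summable_one_div_nat_pow.2 (one_lt_two : 1 < 2)) ?_
  filter_upwards [hgrow.eventually_ge_atTop (2 / c), eventually_ge_atTop 2] with n hn hn2
  have hn0 : (0 : ℝ) < n := by positivity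
  have hlog : 0 < Real.log n := Real.log_pos (by exact_mod_cast hn2)
  rw [div_le_div_iff₀ hc hlog] at hn
  rw [Real.norm_of_nonneg (Real.exp_pos _).le, one_div, ← Real.exp_log (inv_pos.2 (pow_pos hn0 2)),
    Real.exp_le_exp, Real.log_inv, Real.log_pow]
  push_cast
  linarith

lemma packP_le_tsum [PseudoMetricSpace X] [CompactSpace X] {act : G → X → X}
    (hact_cont : ∀ g : G, Continuous (act g)) {Fs : ℕ → Finset G} {Z : Set X} {ε : ℝ}
    (hε : 0 < ε) {N : ℕ} {s h : ℝ}
    (hsep : ∀ n ≥ N, (sepNum act (Fs n) Z ε : ℝ) ≤ Real.exp (h * ((Fs n).card : ℝ))) :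
    packP act Fs Z N ε s ≤ ∑' n : {n // n ∉ Finset.range N},
      ENNReal.ofReal (Real.exp (-(s - h) * ((Fs n).card : ℝ))) := by
  classical
  refine iSup_le fun t => iSup_le fun c => iSup_le fun hc => iSup_le fun hdisj => ?_
  refine ENNReal.summable.tsum_le_of_sum_le fun J => ?_
  rw [Finset.sum_comp (fun n => ENNReal.ofReal (Real.exp (-s * ((Fs n).card : ℝ))))
    (fun i : t => (c i).2)]
  calc _ ≤ ∑ n ∈ J.image fun i : t => (c i).2,
        ENNReal.ofReal (Real.exp (-(s - h) * ((Fs n).card : ℝ))) := by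
        refine Finset.sum_le_sum fun n hn => ?_
        obtain ⟨i, -, rfl⟩ := Finset.mem_image.1 hn
        set n := (c i).2
        have hcard : (J.filter fun j : t => (c j).2 = n).card ≤ sepNum act (Fs n) Z ε := by
          refine card_le_sepNum hact_cont hε _ (fun j : t => (c j).1) (fun j _ => (hc j j.2).1) ?_
          intro j hj k hk hjk
          have := hdisj j j.2 k k.2 (Subtype.coe_injective.ne hjk)
          rwa [(Finset.mem_filter.1 hj).2, (Finset.mem_filter.1 hk).2] at this
        rw [nsmul_eq_mul, ← ENNReal.ofReal_natCast, ← ENNReal.ofReal_mul (Nat.cast_nonneg _)]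
        refine ENNReal.ofReal_le_ofReal ?_
        rw [show -(s - h) * ((Fs n).card : ℝ) = h * (Fs n).card + -s * (Fs n).card by ring,
          Real.exp_add]
        gcongr
        exact (Nat.cast_le.2 hcard).trans (hsep n (hc i i.2).2)
    _ = ∑ n ∈ (J.image fun i : t => (c i).2).subtype (· ∉ Finset.range N),
        ENNReal.ofReal (Real.exp (-(s - h) * ((Fs n).card : ℝ))) := by
        refine (Finset.sum_subtype_of_mem
          (fun n => ENNReal.ofReal (Real.exp (-(s - h) * ((Fs n).card : ℝ)))) fun n hn => ?_).symm
        obtain ⟨i, -, rfl⟩ := Finset.mem_image.1 hn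
        simpa using (hc i i.2).2
    _ ≤ _ := ENNReal.sum_le_tsum _

lemma packPLim_eq_zero [Group G] [PseudoMetricSpace X] [CompactSpace X] {act : G → X → X}
    (hact_cont : ∀ g : G, Continuous (act g)) {Fs : ℕ → Finset G} (hne : ∀ n, (Fs n).Nonempty)
    (hgrow : GrowthCond Fs) {Z : Set X} {ε : ℝ} (hε : 0 < ε) {s : ℝ≥0}
    (hs : ucEntEps act Fs Z ε < s) : packPLim act Fs Z ε s = 0 := by
  obtain ⟨h, hlt, hhs⟩ := ENNReal.lt_iff_exists_nnreal_btwn.1 hs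
  have hpos : (0 : ℝ) < s - h := sub_pos.2 (by exact_mod_cast hhs)
  have hsep : ∀ᶠ n in atTop,
      (sepNum act (Fs n) Z ε : ℝ) ≤ Real.exp (h * ((Fs n).card : ℝ)) := by
    filter_upwards [eventually_lt_of_limsup_lt hlt] with n hn
    have hcard : (0 : ℝ) < (Fs n).card := by exact_mod_cast (hne n).card_pos
    rw [← ENNReal.ofReal_coe_nnreal] at hn
    have hlog := (div_lt_iff₀ hcard).1 (lt_of_not_ge fun hge =>
      (ENNReal.ofReal_le_ofReal hge).not_gt hn)
    exact Real.le_exp_of_log_le hlog.le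
  have htail := (ENNReal.tendsto_tsum_compl_atTop_zero
    (hgrow.summable_exp hpos).tsum_ofReal_ne_top).comp tendsto_finset_range
  refine le_antisymm (ge_of_tendsto htail ?_) zero_le
  filter_upwards [eventually_forall_ge_atTop.2 hsep] with N hN
  exact (iInf_le _ N).trans (packP_le_tsum hact_cont hε hN)

lemma packEntEps_le_ucEntEps [Group G] [PseudoMetricSpace X] [CompactSpace X] {act : G → X → X}
    (hact_cont : ∀ g : G, Continuous (act g)) {Fs : ℕ → Finset G} (hne : ∀ n, (Fs n).Nonempty)
    (hgrow : GrowthCond Fs) (Z : Set X) {ε : ℝ} (hε : 0 < ε) :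
    packEntEps act Fs Z ε ≤ ucEntEps act Fs Z ε := by
  refine le_of_forall_gt fun b hb => ?_
  obtain ⟨s, hs, hsb⟩ := ENNReal.lt_iff_exists_nnreal_btwn.1 hb
  refine lt_of_le_of_lt ?_ hsb
  refine iInf₂_le s (nonpos_iff_eq_zero.1 ?_)
  refine (iInf₂_le (fun _ => Z) (Set.subset_iUnion (fun _ : ℕ => Z) 0)).trans ?_
  simp [packPLim_eq_zero hact_cont hne hgrow hε hs]

theorem packing_entropy_le_upper_capacity_entropy
    [Group G] [Countable G] [Infinite G] [DecidableEq G]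
    [MetricSpace X] [CompactSpace X] [MeasurableSpace X] [BorelSpace X]
    (act : G → X → X)
    (hact_one : ∀ x, act 1 x = x)
    (hact_mul : ∀ g h x, act (g * h) x = act g (act h x))
    (hact_cont : ∀ g : G, Continuous (act g))
    (hamen : ∃ E : ℕ → Finset G, Folner E)
    (Fs : ℕ → Finset G) (hne : ∀ n, (Fs n).Nonempty) (hgrow : GrowthCond Fs) :
    (∀ (Z : Set X) (ε : ℝ), 0 < ε → packEntEps act Fs Z ε ≤ ucEntEps act Fs Z ε) ∧
    (∀ Z : Set X, packEnt act Fs Z ≤ ucEnt act Fs Z) := by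
  have hle := fun (Z : Set X) (ε : ℝ) (hε : 0 < ε) =>
    packEntEps_le_ucEntEps hact_cont hne hgrow Z hε
  exact ⟨hle, fun Z => iSup₂_mono (hle Z)⟩

end AmenablePacking
end
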